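/- Let n ∈ {3,4} and let K be a 1-unconditional convex body in ℝ^n that is not a parallelepiped. Then the illumination number of K satisfies 𝕀(K) ≤ 2^n − 2; moreover, there exists a set D of nonzero directions with D = −D and |D| ≤ 2^n − 2 that illuminates K. -/

import Mathlib

open Set

/-- A convex body in `ℝ^n`: a compact convex set with nonempty interior. -/
def IsConvexBody {n : ℕ} (K : Set (Fin n → ℝ)) : Prop :=
  Convex ℝ K ∧ IsCompact K ∧ (interior K).Nonempty

/-- `K` is 1-unconditional: closed under sign changes of the coordinates. -/
def Unconditional {n : ℕ} (K : Set (Fin n → ℝ)) : Prop :=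
  ∀ x ∈ K, ∀ ε : Fin n → ℝ, (∀ i, ε i = 1 ∨ ε i = -1) → (fun i => ε i * x i) ∈ K

/-- The direction `d` illuminates the (boundary) point `x` of `K`. -/
def Illuminates {n : ℕ} (K : Set (Fin n → ℝ)) (d x : Fin n → ℝ) : Prop :=
  ∃ ε : ℝ, 0 < ε ∧ x + ε • d ∈ interior K

/-- The set of directions `D` illuminates every boundary point of `K`. -/
def IlluminatesSet {n : ℕ} (K : Set (Fin n → ℝ)) (D : Set (Fin n → ℝ)) : Prop :=
  ∀ x ∈ frontier K, ∃ d ∈ D, Illuminates K d x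

/-- The illumination number: smallest cardinality of a set of nonzero directions
illuminating `K`. -/
noncomputable def illumNumber {n : ℕ} (K : Set (Fin n → ℝ)) : ℕ :=
  sInf {m | ∃ D : Finset (Fin n → ℝ), D.card = m ∧ (∀ d ∈ D, d ≠ 0) ∧
    IlluminatesSet K ↑D}

/-- A parallelepiped: an affine image of the cube `[-1,1]^n`. -/
def IsParallelepiped {n : ℕ} (K : Set (Fin n → ℝ)) : Prop :=
  ∃ T : (Fin n → ℝ) ≃ᵃ[ℝ] (Fin n → ℝ),
    K = T '' (Set.Icc (fun _ => (-1 : ℝ)) (fun _ => 1))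

/-- The standard basis vector `e i`. -/
def stdB {n : ℕ} (i : Fin n) : Fin n → ℝ := Pi.single i 1

/-- The class `𝒰^n`: 1-unconditional convex bodies all of whose standard basis
vectors lie on the boundary. -/
def memU {n : ℕ} (K : Set (Fin n → ℝ)) : Prop :=
  IsConvexBody K ∧ Unconditional K ∧ ∀ i : Fin n, stdB i ∈ frontier K

/-- A 1-unconditional body is cubelike if all its extreme points have all
coordinates nonzero. -/
def Cubelike {n : ℕ} (K : Set (Fin n → ℝ)) : Prop :=
  ∀ x ∈ Set.extremePoints ℝ K, ∀ i, x i ≠ 0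

/-- The all-ones vector `𝟙`. -/
def allOnes {n : ℕ} : Fin n → ℝ := fun _ => 1


namespace Ill

/-- normalized body -/
structure Nrm {n : ℕ} (K : Set (Fin n → ℝ)) : Prop where
  conv : Convex ℝ K
  cpt : IsCompact K
  int : (interior K).Nonempty
  unc : Unconditional K
  le1 : ∀ x ∈ K, ∀ i, |x i| ≤ 1
  basis : ∀ i, (Pi.single i 1 : Fin n → ℝ) ∈ K

/-- the conclusion -/
def Good {n : ℕ} (K : Set (Fin n → ℝ)) : Prop :=
  ∃ D : Finset (Fin n → ℝ), (∀ d ∈ D, d ≠ 0) ∧ (∀ d ∈ D, -d ∈ D) ∧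
        D.card ≤ 2 ^ n - 2 ∧ IlluminatesSet K ↑D

/-- admissible functional -/
structure Adm {n : ℕ} (K : Set (Fin n → ℝ)) (x μ : Fin n → ℝ) : Prop where
  nn : ∀ i, 0 ≤ μ i
  ne : μ ≠ 0
  le : ∀ z ∈ K, ∑ i, μ i * |z i| ≤ ∑ i, μ i * |x i|

/-- signed contribution -/
noncomputable def gc (c x m : ℝ) : ℝ := if 0 < c * x then |c| * m else -(|c| * m)

theorem update_mem {n : ℕ} {K : Set (Fin n → ℝ)} (hc : Convex ℝ K) (hu : Unconditional K)
    {x : Fin n → ℝ} (hx : x ∈ K) (i : Fin n) (t : ℝ) (ht : |t| ≤ |x i|) :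
    Function.update x i t ∈ K := by
  have h1 : (Function.update x i (-x i)) ∈ K := by
    have := hu x hx (Function.update (fun _ => 1) i (-1)) (by
      intro j; by_cases h : j = i
      · subst h; simp
      · simp [h])
    convert this using 1
    ext j; by_cases h : j = i
    · subst h; simp
    · simp [h]
  by_cases h0 : x i = 0
  · have : t = 0 := by simpa [h0] using ht
    have : Function.update x i t = x := by rw [this, ← h0]; simp
    rwa [this]
  · obtain ⟨c, hc1, hc2⟩ : ∃ c : ℝ, |c| ≤ 1 ∧ t = c * x i := by
      refine ⟨t / x i, ?_, by field_simp⟩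
      rw [abs_div]; exact div_le_one_of_le₀ ht (abs_nonneg _)
    have hc3 := abs_le.1 hc1
    have := hc hx h1 (a := (1 + c)/2) (b := (1-c)/2) (by linarith) (by linarith) (by ring)
    convert this using 1
    ext j; by_cases h : j = i
    · subst h; simp [hc2]; ring
    · simp [h]; ring

theorem down {n : ℕ} {K : Set (Fin n → ℝ)} (hc : Convex ℝ K) (hu : Unconditional K)
    {x y : Fin n → ℝ} (hx : x ∈ K) (h : ∀ i, |y i| ≤ |x i|) : y ∈ K := by
  classical
  have key : ∀ s : Finset (Fin n), (fun i => if i ∈ s then y i else x i) ∈ K := by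
    intro s
    induction s using Finset.induction_on with
    | empty => simpa using hx
    | insert a s ha ih =>
      have := update_mem hc hu ih a (y a) (by simp [ha, h a])
      convert this using 1
      ext j; by_cases hj : j = a
      · subst hj; simp
      · simp [hj]
  simpa using key Finset.univ

theorem illum_of_adm {n : ℕ} {K : Set (Fin n → ℝ)} (hK : Nrm K) {x : Fin n → ℝ} (hx : x ∈ K)
    (v : Fin n → ℝ) (h : ∀ μ, Adm K x μ → 0 < ∑ i, gc (v i) (x i) (μ i)) :
    Illuminates K (-v) x := by
  by_contra hn
  have hdis : Disjoint (interior K) ((fun ε : ℝ => x + ε • (-v)) '' Set.Ioi 0) := by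
    rw [Set.disjoint_left]
    rintro _ ha ⟨ε, hε, rfl⟩
    exact hn ⟨ε, hε, ha⟩
  have hconvS : Convex ℝ ((fun ε : ℝ => x + ε • (-v)) '' Set.Ioi 0) := by
    have h1 := (convex_Ioi (0:ℝ)).is_linear_image (f := fun ε : ℝ => ε • (-v))
      ((LinearMap.toSpanSingleton ℝ _ (-v)).isLinear)
    have h2 := h1.translate x
    rw [Set.image_image] at h2
    exact h2
  obtain ⟨f, u, hf1, hf2⟩ := geometric_hahn_banach_open hK.conv.interior isOpen_interior hconvS hdis
  have hKu : ∀ z ∈ K, f z ≤ u := by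
    intro z hz
    have hz' : z ∈ closure (interior K) := by
      rw [hK.conv.closure_interior_eq_closure_of_nonempty_interior hK.int]
      exact subset_closure hz
    have : IsClosed {z | f z ≤ u} := isClosed_le f.continuous continuous_const
    exact (this.closure_subset_iff.2 (fun z hz => (hf1 z hz).le)) hz'
  have hb : ∀ ε : ℝ, 0 < ε → u ≤ f x - ε * f v := by
    intro ε hε
    have := hf2 _ ⟨ε, hε, rfl⟩
    simpa [sub_eq_add_neg] using this
  have hfx : u ≤ f x := by
    by_contra hlt
    push Not at hlt
    by_cases hv : 0 ≤ f v
    · have := hb 1 one_pos; linarith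
    · push Not at hv
      have := hb ((u - f x) / (2 * (-f v))) (by apply div_pos <;> linarith)
      have e : (u - f x) / (2 * (-f v)) * f v = -(u - f x) / 2 := by
        have := hv.ne; field_simp
      rw [e] at this; linarith
  have hfx2 := hKu x hx
  have hfv : f v ≤ 0 := by
    have := hb 1 one_pos; linarith
  have hrep : ∀ z : Fin n → ℝ, f z = ∑ i, f (Pi.single i 1) * z i := by
    intro z
    conv_lhs => rw [pi_eq_sum_univ' z]
    rw [map_sum]
    refine Finset.sum_congr rfl fun i _ => ?_
    rw [map_smul, smul_eq_mul, mul_comm]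
  set l : Fin n → ℝ := fun i => f (Pi.single i 1) with hl
  have hle : ∀ z ∈ K, ∑ i, |l i| * |z i| ≤ f x := by
    intro z hz
    have h1 : (fun i => if 0 ≤ l i then |z i| else -|z i|) ∈ K := by
      apply down hK.conv hK.unc hz
      intro i; split_ifs <;> simp
    have := hKu _ h1
    rw [hrep] at this
    refine le_trans (le_of_eq ?_) (this.trans hfx)
    refine Finset.sum_congr rfl fun i _ => ?_
    show _ = l i * _
    by_cases hi : 0 ≤ l i
    · simp [hi, abs_of_nonneg hi]
    · simp [hi, abs_of_neg (not_le.1 hi)]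
  have hxx : ∀ i, l i * x i = |l i| * |x i| := by
    have h1 := hle x hx
    rw [hrep] at h1
    have h2 : ∀ i ∈ Finset.univ, l i * x i ≤ |l i| * |x i| := fun i _ => by
      rw [← abs_mul]; exact le_abs_self _
    have h3 := (Finset.sum_eq_sum_iff_of_le h2).1 (le_antisymm (Finset.sum_le_sum h2) h1)
    exact fun i => h3 i (Finset.mem_univ _)
  have hA : Adm K x (fun i => |l i|) := by
    refine ⟨fun i => abs_nonneg _, ?_, ?_⟩
    · intro h0
      have hl0 : ∀ i, l i = 0 := fun i => by simpa using congrFun h0 i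
      have hf0 : ∀ z, f z = 0 := fun z => by
        rw [hrep]; exact Finset.sum_eq_zero fun i _ => by show l i * _ = 0; simp [hl0]
      obtain ⟨a, ha⟩ := hK.int
      have := hf1 a ha
      rw [hf0] at this hfx; linarith
    · intro z hz
      refine (hle z hz).trans ?_
      rw [hrep]
      exact Finset.sum_le_sum fun i _ => (hxx i).le
  have := h _ hA
  have h5 : ∑ i, gc (v i) (x i) |l i| ≤ f v := by
    rw [hrep]
    refine Finset.sum_le_sum fun i _ => ?_
    show _ ≤ l i * v i
    unfold gc
    split_ifs with hi
    · have : 0 ≤ l i * v i := by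
        by_contra hlt
        push Not at hlt
        have h1 : 0 ≤ l i * x i := by rw [hxx]; positivity
        have : (l i * v i) * (v i * x i) < 0 := mul_neg_of_neg_of_pos hlt hi
        nlinarith [mul_nonneg h1 (sq_nonneg (v i))]
      rw [← abs_mul, mul_comm, abs_of_nonneg this]
    · rw [← abs_mul, mul_comm (v i)]; exact neg_abs_le _
  linarith

end Ill

namespace Ill
open Filter Topology

/-- indicator of a list -/
def ind {n : ℕ} (T : List (Fin n)) : Fin n → ℝ := fun i => if i ∈ T then 1 else 0

/-- list of high coordinates -/
noncomputable def hi {n : ℕ} (ix : List (Fin n)) (κ : ℝ) (x : Fin n → ℝ) : List (Fin n) := by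
  classical exact ix.filter (fun i => decide (1 - κ < |x i|))
/-- positive coordinates -/
noncomputable def psn {n : ℕ} (ix : List (Fin n)) (x : Fin n → ℝ) : List (Fin n) := by
  classical exact ix.filter (fun i => decide (0 < x i))
/-- negative coordinates -/
noncomputable def ngn {n : ℕ} (ix : List (Fin n)) (x : Fin n → ℝ) : List (Fin n) := by
  classical exact ix.filter (fun i => decide (x i < 0))

/-- all sublists -/
def subs {α : Type} : List α → List (List α)
  | [] => [[]]
  | a :: l => subs l ++ (subs l).map (fun t => a :: t)

theorem filter_mem_subs {α : Type} (p : α → Bool) (l : List α) : l.filter p ∈ subs l := by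
  induction l with
  | nil => simp [subs]
  | cons a l ih =>
    by_cases h : p a
    · simp [subs, h, ih]
    · simp [subs, h, ih]

theorem mem_hi {n : ℕ} {ix : List (Fin n)} (hix : ∀ i, i ∈ ix) {κ : ℝ} {x : Fin n → ℝ} {i : Fin n} :
    i ∈ hi ix κ x ↔ 1 - κ < |x i| := by simp [hi, hix]
theorem mem_psn {n : ℕ} {ix : List (Fin n)} (hix : ∀ i, i ∈ ix) {x : Fin n → ℝ} {i : Fin n} :
    i ∈ psn ix x ↔ 0 < x i := by simp [psn, hix]
theorem mem_ngn {n : ℕ} {ix : List (Fin n)} (hix : ∀ i, i ∈ ix) {x : Fin n → ℝ} {i : Fin n} :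
    i ∈ ngn ix x ↔ x i < 0 := by simp [ngn, hix]

/-- nonbad triple -/
def Nonbad {n : ℕ} (K : Set (Fin n → ℝ)) (i j k : Fin n) : Prop :=
  ∀ x ∈ K, |x i| = 1 → ∃ y ∈ K, |x j| < y j ∧ |x k| < y k

theorem ev_small (c : ℝ) (hc : 0 < c) : ∀ᶠ κ in 𝓝[>] (0:ℝ), 0 < κ ∧ κ < c := by
  filter_upwards [Ioo_mem_nhdsGT hc] with κ hκ using hκ

theorem ev_face1 {n : ℕ} {K : Set (Fin n → ℝ)} (hK : Nrm K) (T : List (Fin n)) (hT : ind T ∉ K) :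
    ∀ᶠ κ in 𝓝[>] (0:ℝ), ∀ x ∈ K, ¬ (∀ i ∈ T, 1 - κ < |x i|) := by
  have hop : IsOpen Kᶜ := hK.cpt.isClosed.isOpen_compl
  obtain ⟨ε, hε, hb⟩ := Metric.isOpen_iff.1 hop (ind T) hT
  filter_upwards [ev_small ε hε] with κ hκ x hx h
  have h1 : (fun i => if i ∈ T then |x i| else 0) ∈ K := by
    apply down hK.conv hK.unc hx
    intro i; split_ifs <;> simp
  refine hb ?_ h1
  rw [Metric.mem_ball, dist_pi_lt_iff hε]
  intro i
  by_cases hi : i ∈ T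
  · simp only [hi, ind, if_true, Real.dist_eq]
    have := hK.le1 x hx i
    have := h i hi
    rw [abs_lt]; constructor <;> linarith [hκ.1, hκ.2]
  · simp [hi, ind, hε]

theorem ev_face {n : ℕ} {K : Set (Fin n → ℝ)} (hK : Nrm K) (ix : List (Fin n)) (hix : ∀ i, i ∈ ix) :
    ∀ᶠ κ in 𝓝[>] (0:ℝ), ∀ x ∈ K, ind (hi ix κ x) ∈ K := by
  have h1 : ∀ T ∈ {T | T ∈ subs ix}, ∀ᶠ κ in 𝓝[>] (0:ℝ), ∀ x ∈ K,
      (∀ i ∈ T, 1 - κ < |x i|) → ind T ∈ K := by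
    intro T _
    by_cases hT : ind T ∈ K
    · simp [hT]
    · filter_upwards [ev_face1 hK T hT] with κ h x hx h2
      exact absurd h2 (h x hx)
  have h2 := (Filter.eventually_all_finite (List.finite_toSet (subs ix))).2 h1
  filter_upwards [h2] with κ h x hx
  refine h (hi ix κ x) ?_ x hx (fun i hi => (mem_hi hix).1 hi)
  unfold hi
  exact filter_mem_subs _ _

theorem ev_nb {n : ℕ} {K : Set (Fin n → ℝ)} (hK : Nrm K) {i j k : Fin n} (h : Nonbad K i j k) :
    ∀ᶠ κ in 𝓝[>] (0:ℝ), ∀ x ∈ K, 1 - κ < |x i| →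
      ∃ y ∈ K, |x j| + κ ≤ |y j| ∧ |x k| + κ ≤ |y k| := by
  let U : ℕ → Set (Fin n → ℝ) := fun m =>
    {x | |x i| < 1 - 1 / ((m:ℝ) + 1)} ∪ ⋃ y ∈ K, {x | |x j| + 1 / ((m:ℝ) + 1) < y j ∧ |x k| + 1 / ((m:ℝ) + 1) < y k}
  have hUo : ∀ m, IsOpen (U m) := by
    intro m
    refine IsOpen.union (isOpen_lt (by fun_prop) (by fun_prop)) ?_
    refine isOpen_biUnion fun y _ => ?_
    refine IsOpen.and ?_ ?_
    · exact isOpen_lt (by fun_prop) (by fun_prop)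
    · exact isOpen_lt (by fun_prop) (by fun_prop)
  have hanti : ∀ m m' : ℕ, m ≤ m' → 1 / ((m':ℝ) + 1) ≤ 1 / ((m:ℝ) + 1) := by
    intro m m' h
    exact one_div_le_one_div_of_le (by positivity) (by gcongr)
  have hmono : Monotone U := by
    intro m m' hm x hx
    have := hanti m m' hm
    rcases hx with hx | hx
    · left; simp only [Set.mem_ofPred_eq] at hx ⊢; linarith
    · right
      simp only [Set.mem_iUnion, Set.mem_ofPred_eq] at hx ⊢
      obtain ⟨y, hy, h1, h2⟩ := hx
      exact ⟨y, hy, by linarith, by linarith⟩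
  have hsm : ∀ c : ℝ, 0 < c → ∃ m : ℕ, 1 / ((m:ℝ) + 1) < c := fun c hc => exists_nat_one_div_lt hc
  have hcov : K ⊆ ⋃ m, U m := by
    intro x hx
    rw [Set.mem_iUnion]
    rcases (hK.le1 x hx i).lt_or_eq with h1 | h1
    · obtain ⟨m, hm⟩ := hsm (1 - |x i|) (by linarith)
      exact ⟨m, Or.inl (by simp only [Set.mem_ofPred_eq]; linarith)⟩
    · obtain ⟨y, hy, h2, h3⟩ := h x hx h1
      obtain ⟨m, hm⟩ := hsm (min (y j - |x j|) (y k - |x k|)) (lt_min (by linarith) (by linarith))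
      rw [lt_min_iff] at hm
      refine ⟨m, Or.inr ?_⟩
      simp only [Set.mem_iUnion, Set.mem_ofPred_eq]
      exact ⟨y, hy, by linarith, by linarith⟩
  obtain ⟨m, hm⟩ := hK.cpt.elim_directed_cover U hUo hcov hmono.directed_le
  filter_upwards [ev_small (1 / ((m:ℝ) + 1)) (by positivity)] with κ hκ x hx h1
  rcases hm hx with h2 | h2
  · simp only [Set.mem_ofPred_eq] at h2; linarith
  · simp only [Set.mem_iUnion, Set.mem_ofPred_eq] at h2
    obtain ⟨y, hy, h3, h4⟩ := h2
    exact ⟨y, hy, by linarith [le_abs_self (y j)], by linarith [le_abs_self (y k)]⟩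

/-- mass of the support outside `T` -/
noncomputable def mass {n : ℕ} (x μ : Fin n → ℝ) (T : List (Fin n)) : ℝ :=
  ∑ i, if x i ≠ 0 ∧ i ∉ T then μ i else 0

theorem dom {n : ℕ} {K : Set (Fin n → ℝ)} {x μ : Fin n → ℝ} (hK : Nrm K) (hx : x ∈ K)
    (hA : Adm K x μ) {y : Fin n → ℝ} (hy : y ∈ K) (T : List (Fin n))
    (hT : ∀ i ∈ T, |x i| ≤ |y i|) {j : Fin n} (hj : j ∈ T) {κ : ℝ} (hκ : |x j| + κ ≤ |y j|) :
    κ * μ j ≤ mass x μ T := by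
  have h1 := hA.le y hy
  have h2 : ∀ i ∈ Finset.univ, (if i = j then κ * μ j else 0) - (if x i ≠ 0 ∧ i ∉ T then μ i else 0) ≤
      μ i * |y i| - μ i * |x i| := by
    intro i _
    have hm := hA.nn i
    have hx1 := hK.le1 x hx i
    by_cases hij : i = j
    · subst hij
      simp only [hj, if_true, not_true, and_false, if_false]
      nlinarith
    · simp only [hij, if_false]
      by_cases hiT : i ∈ T
      · simp only [hiT, not_true, and_false, if_false]
        nlinarith [hT i hiT]
      · by_cases h0 : x i = 0
        · simp only [h0, abs_zero, ne_eq, not_true, false_and, if_false]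
          nlinarith [abs_nonneg (y i)]
        · simp only [h0, hiT, ne_eq, not_false_iff, and_self, if_true]
          nlinarith [abs_nonneg (y i)]
  have h3 := Finset.sum_le_sum h2
  rw [Finset.sum_sub_distrib, Finset.sum_sub_distrib, Finset.sum_ite_eq'] at h3
  simp only [Finset.mem_univ, if_true] at h3
  unfold mass
  linarith

theorem mass_nonneg {n : ℕ} {x μ : Fin n → ℝ} (h : ∀ i, 0 ≤ μ i) (T : List (Fin n)) : 0 ≤ mass x μ T :=
  Finset.sum_nonneg fun i _ => by split_ifs <;> simp [h]

theorem dom_extra {n : ℕ} {K : Set (Fin n → ℝ)} {x μ : Fin n → ℝ} (hK : Nrm K) (hx : x ∈ K)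
    (hA : Adm K x μ) (T : List (Fin n)) {κ : ℝ} (hκ : 0 < κ) (hκ1 : κ ≤ 1)
    (hT : ∀ i ∈ T, κ * μ i ≤ mass x μ T) (j : Fin n) :
    κ * μ j ≤ (n + 1) * mass x μ T := by
  have h1 := hA.le _ (hK.basis j)
  have h2 : ∑ i, μ i * |(Pi.single j 1 : Fin n → ℝ) i| = μ j := by
    rw [Finset.sum_eq_single j]
    · simp
    · intro i _ hij; simp [hij]
    · simp
  rw [h2] at h1
  have h3 : ∀ i ∈ Finset.univ, κ * (μ i * |x i|) ≤ κ * (if x i ≠ 0 ∧ i ∉ T then μ i else 0) + mass x μ T := by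
    intro i _
    have hm := hA.nn i
    have hx1 := hK.le1 x hx i
    have hM := mass_nonneg (x := x) hA.nn T
    have h4 : μ i * |x i| ≤ μ i := by nlinarith
    have h5 : κ * (μ i * |x i|) ≤ κ * μ i := by gcongr
    by_cases hiT : i ∈ T
    · simp only [hiT, not_true, and_false, if_false]
      linarith [hT i hiT]
    · by_cases h0 : x i = 0
      · simp only [h0, abs_zero, ne_eq, not_true, false_and, if_false]
        linarith
      · simp only [h0, hiT, ne_eq, not_false_iff, and_self, if_true]
        linarith
  have h4 := Finset.sum_le_sum h3
  rw [← Finset.mul_sum, Finset.sum_add_distrib, ← Finset.mul_sum] at h4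
  change _ ≤ κ * mass x μ T + _ at h4
  simp only [Finset.sum_const, Finset.card_univ, Fintype.card_fin, nsmul_eq_mul] at h4
  have hM := mass_nonneg (x := x) hA.nn T
  have : κ * mass x μ T ≤ mass x μ T := by nlinarith
  have : κ * μ j ≤ κ * ∑ i, μ i * |x i| := by gcongr
  linarith

end Ill

namespace Ill
open Filter Topology

/-- boolean membership -/
def el {n : ℕ} : List (Fin n) → Fin n → Bool
  | [], _ => false
  | a :: l, i => Nat.beq a.1 i.1 || el l i

theorem el_iff {n : ℕ} (l : List (Fin n)) (i : Fin n) : el l i = true ↔ i ∈ l := by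
  induction l with
  | nil => simp [el]
  | cons a l ih =>
    simp only [el, Bool.or_eq_true, ih, List.mem_cons, Nat.beq_eq]
    rw [Fin.ext_iff, eq_comm]

/-- A flag direction: sign and level for every coordinate. -/
abbrev Flag (n : ℕ) := Fin n → Bool × ℕ

/-- extra faces coming from nonbad triples -/
def nbT {n : ℕ} (H : List (Fin n)) : List (Fin n × Fin n × Fin n) → List (List (Fin n))
  | [] => []
  | t :: l => if el H t.1 then [t.2.1, t.2.2] :: nbT H l else nbT H l

/-- is the coordinate right -/
def rt {n : ℕ} (P N : List (Fin n)) (f : Flag n) (i : Fin n) : Bool :=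
  match (f i).1 with
  | true => el P i
  | false => el N i

/-- condition on coordinate `j` -/
def okj {n : ℕ} (cs : List (List (Fin n))) (P N H : List (Fin n)) (f : Flag n) (j : Fin n) : Bool :=
  rt P N f j || (!el H j && cs.any (fun T =>
    (el T j || (!el P j && (!el N j && T.all (fun i => !el H i)))) &&
    (P ++ N).all (fun i => el T i || (rt P N f i && Nat.blt (f i).2 (f j).2))))

/-- the flag illuminates the state -/
def ill {n : ℕ} (ix : List (Fin n)) (fs : List (List (Fin n))) (nb : List (Fin n × Fin n × Fin n))
    (P N H : List (Fin n)) (f : Flag n) : Bool :=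
  ix.all (okj (fs ++ nbT H nb) P N H f)

/-- check all states -/
def check {n : ℕ} (ix : List (Fin n)) (fs : List (List (Fin n))) (nb : List (Fin n × Fin n × Fin n))
    (fls : List (Flag n)) (spec : List (Fin n) → List (Fin n) → List (Fin n) → Bool) : Bool :=
  (subs ix).all fun P => (subs ix).all fun N => !(P.all fun i => !el N i) ||
    fs.all fun H => !(H.all fun i => el P i || el N i) ||
      (fls.any (ill ix fs nb P N H) || spec P N H)

/-- the direction vector -/
noncomputable def dir {n : ℕ} (η : ℝ) (f : Flag n) : Fin n → ℝ :=
  fun i => (if (f i).1 then 1 else -1) * η ^ (f i).2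

/-- negated flag -/
def negf {n : ℕ} (f : Flag n) : Flag n := fun i => (!(f i).1, (f i).2)

theorem dir_negf {n : ℕ} (η : ℝ) (f : Flag n) : dir η (negf f) = - dir η f := by
  ext i
  simp only [dir, negf, Pi.neg_apply]
  by_cases h : (f i).1 = true <;> simp [h]

theorem mem_nbT {n : ℕ} {H T : List (Fin n)} {nb : List (Fin n × Fin n × Fin n)} (h : T ∈ nbT H nb) :
    ∃ t ∈ nb, t.1 ∈ H ∧ T = [t.2.1, t.2.2] := by
  induction nb with
  | nil => simp [nbT] at h
  | cons a l ih =>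
    unfold nbT at h
    split_ifs at h with ha
    · rcases List.mem_cons.1 h with h | h
      · exact ⟨a, by simp, (el_iff _ _).1 ha, h⟩
      · obtain ⟨t, h1, h2⟩ := ih h
        exact ⟨t, by simp [h1], h2⟩
    · obtain ⟨t, h1, h2⟩ := ih h
      exact ⟨t, by simp [h1], h2⟩

theorem rt_iff {n : ℕ} {ix : List (Fin n)} (hix : ∀ i, i ∈ ix) {x : Fin n → ℝ} (f : Flag n) {η : ℝ}
    (hη : 0 < η) (i : Fin n) :
    rt (psn ix x) (ngn ix x) f i = true ↔ 0 < dir η f i * x i := by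
  have hp : 0 < η ^ (f i).2 := by positivity
  unfold rt dir
  cases h : (f i).1
  · simp only [el_iff, mem_ngn hix, Bool.false_eq_true, if_false]
    rw [show (-1 * η ^ (f i).2 * x i) = η ^ (f i).2 * (-x i) by ring, mul_pos_iff_of_pos_left hp]
    simp
  · simp only [el_iff, mem_psn hix, if_true]
    rw [one_mul, mul_pos_iff_of_pos_left hp]

theorem abs_dir {n : ℕ} (f : Flag n) {η : ℝ} (hη : 0 < η) (i : Fin n) : |dir η f i| = η ^ (f i).2 := by
  have hp : 0 < η ^ (f i).2 := by positivity
  unfold dir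
  cases h : (f i).1 <;> simp [abs_of_pos hη]

/-- combinatorial part of machine: levels -/
theorem level_sum {n : ℕ} (x μ : Fin n → ℝ) (hμ : ∀ i, 0 ≤ μ i) (hne : μ ≠ 0) (f : Flag n) {η C : ℝ} (hη : 0 < η)
    (hη1 : η ≤ 1) (hC : 0 ≤ C) (hηC : η * (n * C) < 1)
    (h : ∀ j, ¬ 0 < dir η f j * x j → μ j ≤ C * ∑ i, if 0 < dir η f i * x i ∧ (f i).2 < (f j).2 then μ i else 0) :
    0 < ∑ i, gc (dir η f i) (x i) (μ i) := by
  set R := ∑ i, if 0 < dir η f i * x i then η ^ (f i).2 * μ i else 0 with hR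
  have hR0 : 0 ≤ R := Finset.sum_nonneg fun i _ => by
    split_ifs
    · have := hμ i; positivity
    · exact le_rfl
  have hw : ∀ j, ¬ 0 < dir η f j * x j → η ^ (f j).2 * μ j ≤ C * η * R := by
    intro j hj
    have h1 := h j hj
    set Q := ∑ i, if 0 < dir η f i * x i ∧ (f i).2 < (f j).2 then μ i else 0 with hQ
    have h2 : η ^ (f j).2 * Q ≤ η * R := by
      rw [hQ, hR, Finset.mul_sum, Finset.mul_sum]
      refine Finset.sum_le_sum fun i _ => ?_
      have := hμ i
      by_cases ha : 0 < dir η f i * x i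
      · by_cases hb : (f i).2 < (f j).2
        · simp only [ha, hb, and_self, if_true]
          have : η ^ (f j).2 ≤ η ^ ((f i).2 + 1) := pow_le_pow_of_le_one hη.le hη1 hb
          rw [← mul_assoc, ← pow_succ']
          gcongr
        · simp only [ha, hb, and_false, if_false, if_true]
          have : 0 ≤ η * (η ^ (f i).2 * μ i) := by positivity
          simpa using this
      · simp [ha]
    have hp : 0 < η ^ (f j).2 := by positivity
    calc η ^ (f j).2 * μ j ≤ η ^ (f j).2 * (C * Q) := by gcongr
      _ = C * (η ^ (f j).2 * Q) := by ring
      _ ≤ C * (η * R) := by gcongr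
      _ = C * η * R := by ring
  have hRpos : 0 < R := by
    rcases hR0.lt_or_eq with h0 | h0
    · exact h0
    · exfalso
      apply hne
      ext j
      have hp : 0 < η ^ (f j).2 := by positivity
      have hj := hμ j
      by_cases ha : 0 < dir η f j * x j
      · have := (Finset.sum_eq_zero_iff_of_nonneg (fun i _ => by
          have := hμ i
          split_ifs <;> positivity)).1 h0.symm j (Finset.mem_univ _)
        simp only [ha, if_true] at this
        rcases mul_eq_zero.1 this with h | h
        · exact absurd h hp.ne'
        · exact h
      · have := hw j ha
        rw [← h0, mul_zero] at this
        have : μ j ≤ 0 := by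
          by_contra hc; push Not at hc
          have := mul_pos hp hc
          linarith
        simpa using le_antisymm this hj
  have hsum : ∀ i ∈ Finset.univ, (if 0 < dir η f i * x i then η ^ (f i).2 * μ i else 0) - C * η * R ≤
      gc (dir η f i) (x i) (μ i) := by
    intro i _
    unfold gc
    rw [abs_dir f hη]
    have : 0 ≤ C * η * R := by positivity
    split_ifs with ha
    · linarith
    · linarith [hw i ha]
  have := Finset.sum_le_sum hsum
  rw [Finset.sum_sub_distrib, ← hR] at this
  simp only [Finset.sum_const, Finset.card_univ, Fintype.card_fin, nsmul_eq_mul] at this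
  have h6 : 0 < (1 - η * (n * C)) * R := mul_pos (by linarith) hRpos
  nlinarith

theorem machine {n : ℕ} {K : Set (Fin n → ℝ)} (hK : Nrm K) (ix : List (Fin n)) (hix : ∀ i, i ∈ ix)
    (fs : List (List (Fin n))) (nb : List (Fin n × Fin n × Fin n))
    (hfs : ∀ T ∈ fs, ind T ∈ K) (hfs' : ∀ T ∈ subs ix, ind T ∈ K → T ∈ fs)
    (hnb : ∀ t ∈ nb, Nonbad K t.1 t.2.1 t.2.2) :
    ∃ κ : ℝ, 0 < κ ∧ κ ≤ 1 ∧ (∀ x ∈ K, hi ix κ x ∈ fs) ∧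
      ∀ᶠ η in 𝓝[>] (0:ℝ), ∀ x ∈ K, ∀ f : Flag n,
        ill ix fs nb (psn ix x) (ngn ix x) (hi ix κ x) f = true → Illuminates K (-(dir η f)) x := by
  have hnb2 : ∀ᶠ κ in 𝓝[>] (0:ℝ), ∀ t ∈ {t | t ∈ nb}, ∀ x ∈ K, 1 - κ < |x t.1| →
      ∃ y ∈ K, |x t.2.1| + κ ≤ |y t.2.1| ∧ |x t.2.2| + κ ≤ |y t.2.2| :=
    (Filter.eventually_all_finite (List.finite_toSet nb)).2 (fun t ht => ev_nb hK (hnb t ht))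
  obtain ⟨κ, hκ1, hκ2, hκ3⟩ := ((ev_face hK ix hix).and (hnb2.and (ev_small 1 one_pos))).exists
  refine ⟨κ, hκ3.1, hκ3.2.le, ?_, ?_⟩
  · intro x hx
    refine hfs' _ ?_ (hκ1 x hx)
    unfold hi; exact filter_mem_subs _ _
  set C : ℝ := (n + 1) / κ with hC
  have hκ0 := hκ3.1
  have hC0 : 0 < C := by positivity
  filter_upwards [ev_small (min 1 (1 / (n * C + 1))) (lt_min one_pos (by positivity))] with η hη x hx f hf
  obtain ⟨hη0, hη1⟩ := hη
  rw [lt_min_iff, lt_div_iff₀ (by positivity)] at hη1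
  refine illum_of_adm hK hx _ fun μ hA => ?_
  refine level_sum x μ hA.nn hA.ne f hη0 hη1.1.le hC0.le (by nlinarith [hη1.2]) ?_
  intro j hj
  have hok := List.all_eq_true.1 hf j (hix j)
  unfold okj at hok
  rw [Bool.or_eq_true, rt_iff hix f hη0] at hok
  replace hok := hok.resolve_left hj
  rw [Bool.and_eq_true, List.any_eq_true] at hok
  obtain ⟨hjH, T, hTm, hT⟩ := hok
  rw [Bool.and_eq_true] at hT
  obtain ⟨hT1, hT2⟩ := hT
  have hjH' : |x j| ≤ 1 - κ := by
    rw [Bool.not_eq_true', ← Bool.not_eq_true, el_iff, mem_hi hix] at hjH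
    linarith
  -- domination
  have hd1 : ∀ i ∈ T, |x i| ≤ 1 - κ → κ * μ i ≤ mass x μ T := by
    intro i hi hlow
    rcases List.mem_append.1 hTm with hTm | hTm
    · refine dom hK hx hA (hfs T hTm) T ?_ hi ?_
      · intro i hi; simp [ind, hi, hK.le1 x hx i]
      · simp [ind, hi]; linarith
    · obtain ⟨t, ht, htH, rfl⟩ := mem_nbT hTm
      obtain ⟨y, hy, hy1, hy2⟩ := hκ2 t ht x hx ((mem_hi hix).1 htH)
      refine dom hK hx hA hy _ ?_ hi ?_
      · intro i hi
        simp only [List.mem_cons, List.not_mem_nil, or_false] at hi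
        rcases hi with rfl | rfl <;> linarith
      · simp only [List.mem_cons, List.not_mem_nil, or_false] at hi
        rcases hi with rfl | rfl <;> linarith
  have hM := mass_nonneg (x := x) hA.nn T
  have hd : κ * μ j ≤ (n + 1) * mass x μ T := by
    rw [Bool.or_eq_true] at hT1
    rcases hT1 with hT1 | hT1
    · have := hd1 j ((el_iff _ _).1 hT1) hjH'
      have : (0:ℝ) ≤ n * mass x μ T := by positivity
      linarith
    · rw [Bool.and_eq_true, Bool.and_eq_true, List.all_eq_true] at hT1
      refine dom_extra hK hx hA T hκ0 hκ3.2.le ?_ j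
      intro i hi
      refine hd1 i hi ?_
      have := hT1.2.2 i hi
      rw [Bool.not_eq_true', ← Bool.not_eq_true, el_iff, mem_hi hix] at this
      linarith
  have hmass : mass x μ T ≤ ∑ i, if 0 < dir η f i * x i ∧ (f i).2 < (f j).2 then μ i else 0 := by
    refine Finset.sum_le_sum fun i _ => ?_
    by_cases hi : x i ≠ 0 ∧ i ∉ T
    · rw [if_pos hi]
      rw [List.all_eq_true] at hT2
      have hmem : i ∈ psn ix x ++ ngn ix x := by
        rw [List.mem_append, mem_psn hix, mem_ngn hix]
        rcases lt_or_gt_of_ne hi.1 with h | h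
        · exact Or.inr h
        · exact Or.inl h
      have := hT2 i hmem
      rw [Bool.or_eq_true, el_iff, Bool.and_eq_true, rt_iff hix f hη0] at this
      have := this.resolve_left hi.2
      rw [if_pos ⟨this.1, by simpa [Nat.blt_eq] using this.2⟩]
    · rw [if_neg hi]
      have := hA.nn i
      split_ifs <;> simp [this]
  have h7 : κ * μ j ≤ (n + 1) * ∑ i, if 0 < dir η f i * x i ∧ (f i).2 < (f j).2 then μ i else 0 :=
    hd.trans (by gcongr)
  rw [hC, div_mul_eq_mul_div, le_div_iff₀ hκ0]
  linarith

theorem good_of_flags {n : ℕ} (hn : 0 < n) {K : Set (Fin n → ℝ)} (hK : Nrm K) (fls : List (Flag n))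
    (hlen : fls.length * 2 ≤ 2 ^ n - 2) {η : ℝ} (hη : 0 < η)
    (h : ∀ x ∈ K, ∃ f ∈ fls ++ fls.map negf, Illuminates K (-(dir η f)) x) : Good K := by
  classical
  refine ⟨((fls ++ fls.map negf).map (dir η)).toFinset, ?_, ?_, ?_, ?_⟩
  · intro d hd
    simp only [List.mem_toFinset, List.mem_map] at hd
    obtain ⟨f, -, rfl⟩ := hd
    intro h0
    have h1 := abs_dir f hη ⟨0, hn⟩
    rw [h0] at h1
    have : 0 < η ^ (f ⟨0, hn⟩).2 := by positivity
    simp at h1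
    linarith
  · intro d hd
    simp only [List.mem_toFinset, List.mem_map, List.mem_append] at hd ⊢
    obtain ⟨f, hf | ⟨g, hg, rfl⟩, rfl⟩ := hd
    · exact ⟨negf f, Or.inr ⟨f, hf, rfl⟩, dir_negf _ _⟩
    · exact ⟨g, Or.inl hg, by rw [dir_negf, neg_neg]⟩
  · refine (List.toFinset_card_le _).trans ?_
    simp only [List.length_map, List.length_append]
    omega
  · intro x hx
    obtain ⟨f, hf, hi⟩ := h x (hK.cpt.isClosed.frontier_subset hx)
    refine ⟨-(dir η f), ?_, hi⟩
    simp only [List.coe_toFinset, Set.mem_ofPred_eq, List.mem_map]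
    rcases List.mem_append.1 hf with h | h
    · exact ⟨negf f, List.mem_append_right _ (List.mem_map.2 ⟨f, h, rfl⟩), dir_negf _ _⟩
    · obtain ⟨g, hg, rfl⟩ := List.mem_map.1 h
      exact ⟨g, List.mem_append_left _ hg, by rw [dir_negf, neg_neg]⟩

theorem check_use {n : ℕ} {ix : List (Fin n)} (hix : ∀ i, i ∈ ix) {fs : List (List (Fin n))}
    {nb : List (Fin n × Fin n × Fin n)} {fls : List (Flag n)}
    {spec : List (Fin n) → List (Fin n) → List (Fin n) → Bool} (hch : check ix fs nb fls spec = true)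
    {κ : ℝ} (hκ : κ ≤ 1) (x : Fin n → ℝ) (hH : hi ix κ x ∈ fs) :
    (∃ f ∈ fls, ill ix fs nb (psn ix x) (ngn ix x) (hi ix κ x) f = true) ∨
      spec (psn ix x) (ngn ix x) (hi ix κ x) = true := by
  unfold check at hch
  rw [List.all_eq_true] at hch
  have h1 := hch (psn ix x) (by unfold psn; exact filter_mem_subs _ _)
  rw [List.all_eq_true] at h1
  have h2 := h1 (ngn ix x) (by unfold ngn; exact filter_mem_subs _ _)
  rw [Bool.or_eq_true] at h2
  have h3 : ((psn ix x).all fun i => !el (ngn ix x) i) = true := by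
    rw [List.all_eq_true]
    intro i hi
    rw [mem_psn hix] at hi
    rw [Bool.not_eq_true', ← Bool.not_eq_true, el_iff, mem_ngn hix]
    linarith
  rw [h3] at h2
  have h4 := h2.resolve_left (by simp)
  rw [List.all_eq_true] at h4
  have h5 := h4 _ hH
  have h6 : ((hi ix κ x).all fun i => el (psn ix x) i || el (ngn ix x) i) = true := by
    rw [List.all_eq_true]
    intro i hi
    rw [mem_hi hix] at hi
    rw [Bool.or_eq_true, el_iff, el_iff, mem_ngn hix, mem_psn hix]
    have : x i ≠ 0 := by
      intro h0; rw [h0, abs_zero] at hi; linarith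
    exact (lt_or_gt_of_ne this).symm
  rw [h6, Bool.or_eq_true] at h5
  have h7 := h5.resolve_left (by simp)
  rw [Bool.or_eq_true, List.any_eq_true] at h7
  exact h7

theorem good_of_check {n : ℕ} (hn : 0 < n) {K : Set (Fin n → ℝ)} (hK : Nrm K) (ix : List (Fin n))
    (hix : ∀ i, i ∈ ix)
    (fs : List (List (Fin n))) (nb : List (Fin n × Fin n × Fin n)) (fls : List (Flag n))
    (hlen : fls.length * 2 ≤ 2 ^ n - 2)
    (hch : check ix fs nb (fls ++ fls.map negf) (fun _ _ _ => false) = true)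
    (hfs : ∀ T ∈ subs ix, ind T ∈ K ↔ T ∈ fs) (hfs2 : ∀ T ∈ fs, T ∈ subs ix)
    (hnb : ∀ t ∈ nb, Nonbad K t.1 t.2.1 t.2.2) : Good K := by
  obtain ⟨κ, h0, h1, h2, h3⟩ := machine hK ix hix fs nb (fun T hT => (hfs T (hfs2 T hT)).2 hT)
    (fun T hT h => (hfs T hT).1 h) hnb
  obtain ⟨η, hη, hη0⟩ := (h3.and (ev_small 1 one_pos)).exists
  refine good_of_flags hn hK fls hlen hη0.1 fun x hx => ?_
  rcases check_use hix hch h1 x (h2 x hx) with ⟨f, hf, hi⟩ | h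
  · exact ⟨f, hf, hη x hx f hi⟩
  · simp at h

end Ill

namespace Ill
open Filter Topology

theorem good_image {n : ℕ} {K : Set (Fin n → ℝ)} (L : (Fin n → ℝ) ≃L[ℝ] (Fin n → ℝ))
    (h : Good (L '' K)) : Good K := by
  classical
  obtain ⟨D, h1, h2, h3, h4⟩ := h
  refine ⟨D.image L.symm, ?_, ?_, Finset.card_image_le.trans h3, ?_⟩
  · intro d hd
    obtain ⟨e, he, rfl⟩ := Finset.mem_image.1 hd
    intro h0
    exact h1 e he (by simpa using h0)
  · intro d hd
    obtain ⟨e, he, rfl⟩ := Finset.mem_image.1 hd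
    exact Finset.mem_image.2 ⟨-e, h2 e he, by simp⟩
  · intro x hx
    have hf : L x ∈ frontier (L '' K) := by
      have := L.toHomeomorph.image_frontier K
      have h5 : L x ∈ L.toHomeomorph '' frontier K := ⟨x, hx, rfl⟩
      rw [this] at h5
      exact h5
    obtain ⟨d, hd, ε, hε, hi⟩ := h4 _ hf
    refine ⟨L.symm d, ?_, ε, hε, ?_⟩
    · simp only [Finset.coe_image]
      exact ⟨d, hd, rfl⟩
    · have h6 : L x + ε • d ∈ L.toHomeomorph '' interior K := by
        rw [L.toHomeomorph.image_interior K]; exact hi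
      obtain ⟨y, hy, hy2⟩ := h6
      have hy3 : L y = L x + ε • d := hy2
      have : x + ε • L.symm d = y := by
        apply L.injective
        rw [hy3]; simp
      rwa [this]

theorem par_image {n : ℕ} {K : Set (Fin n → ℝ)} (L : (Fin n → ℝ) ≃L[ℝ] (Fin n → ℝ))
    (h : IsParallelepiped (L '' K)) : IsParallelepiped K := by
  obtain ⟨T, hT⟩ := h
  refine ⟨T.trans L.symm.toLinearEquiv.toAffineEquiv, ?_⟩
  have : K = L.symm '' (L '' K) := by
    rw [Set.image_image]; simp
  rw [this, hT, Set.image_image]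
  rfl

theorem body_image {n : ℕ} {K : Set (Fin n → ℝ)} (L : (Fin n → ℝ) ≃L[ℝ] (Fin n → ℝ))
    (h : IsConvexBody K) : IsConvexBody (L '' K) := by
  obtain ⟨h1, h2, h3⟩ := h
  refine ⟨h1.linear_image L.toLinearEquiv.toLinearMap, h2.image L.continuous, ?_⟩
  have := L.toHomeomorph.image_interior K
  have h4 : (L.toHomeomorph '' interior K).Nonempty := h3.image _
  rw [this] at h4
  exact h4

/-- diagonal scaling -/
noncomputable def diagL {n : ℕ} (m : Fin n → ℝ) (hm : ∀ i, 0 < m i) : (Fin n → ℝ) ≃L[ℝ] (Fin n → ℝ) :=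
  LinearEquiv.toContinuousLinearEquiv
    { toFun := fun x i => x i / m i
      invFun := fun x i => x i * m i
      map_add' := fun x y => by ext i; simp [add_div]
      map_smul' := fun c x => by ext i; simp [mul_div_assoc]
      left_inv := fun x => by ext i; have := (hm i).ne'; field_simp
      right_inv := fun x => by ext i; have := (hm i).ne'; field_simp }

theorem diagL_apply {n : ℕ} (m : Fin n → ℝ) (hm : ∀ i, 0 < m i) (x : Fin n → ℝ) (i : Fin n) :
    diagL m hm x i = x i / m i := rfl

theorem normalize {n : ℕ} {K : Set (Fin n → ℝ)} (hb : IsConvexBody K) (hu : Unconditional K) :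
    ∃ L : (Fin n → ℝ) ≃L[ℝ] (Fin n → ℝ), Nrm (L '' K) := by
  obtain ⟨hc, hcp, hint⟩ := hb
  have hne : K.Nonempty := hint.mono interior_subset
  have hmax : ∀ i, ∃ x ∈ K, ∀ y ∈ K, |y i| ≤ |x i| := fun i => by
    obtain ⟨x, hx, h⟩ := hcp.exists_isMaxOn hne (f := fun x => |x i|) (by fun_prop)
    exact ⟨x, hx, fun y hy => h hy⟩
  choose X hX hXm using hmax
  have hpos : ∀ i, 0 < |X i i| := by
    intro i
    obtain ⟨a, ha⟩ := hint
    obtain ⟨ε, hε, hball⟩ := Metric.isOpen_iff.1 isOpen_interior a ha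
    have hmem : ∀ t : ℝ, |t| < ε → a + Pi.single i t ∈ K := by
      intro t ht
      apply interior_subset
      apply hball
      rw [Metric.mem_ball, dist_pi_lt_iff hε]
      intro j
      by_cases hj : j = i
      · subst hj; simpa [Real.dist_eq] using ht
      · simpa [hj] using hε
    have h1 := hXm i _ (hmem (ε/2) (by rw [abs_of_pos] <;> linarith))
    have h2 := hXm i _ (hmem (-(ε/2)) (by rw [abs_neg, abs_of_pos] <;> linarith))
    simp at h1 h2
    have h3 := le_abs_self (a i + ε/2)
    have h4 := neg_abs_le (a i + -(ε/2))
    linarith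
  refine ⟨diagL (fun i => |X i i|) hpos, ?_⟩
  have hb2 := body_image (diagL (fun i => |X i i|) hpos) ⟨hc, hcp, hint⟩
  refine ⟨hb2.1, hb2.2.1, hb2.2.2, ?_, ?_, ?_⟩
  · rintro _ ⟨x, hx, rfl⟩ ε hε
    refine ⟨_, hu x hx ε hε, ?_⟩
    ext i; simp only [diagL_apply]; ring
  · rintro _ ⟨x, hx, rfl⟩ i
    rw [diagL_apply, abs_div, abs_abs]
    exact div_le_one_of_le₀ (hXm i x hx) (abs_nonneg _)
  · intro i
    refine ⟨Pi.single i |X i i|, ?_, ?_⟩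
    · apply down hc hu (hX i)
      intro j
      by_cases hj : j = i
      · subst hj; simp
      · simp [hj]
    · ext j
      rw [diagL_apply]
      by_cases hj : j = i
      · subst hj; simp [(hpos j).ne', abs_pos.1 (hpos j)]
      · simp [hj]

/-- permuting coordinates -/
noncomputable def permL {n : ℕ} (σ : Equiv.Perm (Fin n)) : (Fin n → ℝ) ≃L[ℝ] (Fin n → ℝ) :=
  LinearEquiv.toContinuousLinearEquiv
    { toFun := fun x i => x (σ i)
      invFun := fun x i => x (σ.symm i)
      map_add' := fun x y => by ext i; simp
      map_smul' := fun c x => by ext i; simp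
      left_inv := fun x => by ext i; simp
      right_inv := fun x => by ext i; simp }

theorem permL_apply {n : ℕ} (σ : Equiv.Perm (Fin n)) (x : Fin n → ℝ) (i : Fin n) :
    permL σ x i = x (σ i) := rfl
theorem permL_symm_apply {n : ℕ} (σ : Equiv.Perm (Fin n)) (x : Fin n → ℝ) (i : Fin n) :
    (permL σ).symm x i = x (σ.symm i) := rfl

theorem nrm_perm {n : ℕ} {K : Set (Fin n → ℝ)} (hK : Nrm K) (σ : Equiv.Perm (Fin n)) :
    Nrm (permL σ '' K) := by
  have hb2 := body_image (permL σ) ⟨hK.conv, hK.cpt, hK.int⟩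
  refine ⟨hb2.1, hb2.2.1, hb2.2.2, ?_, ?_, ?_⟩
  · rintro _ ⟨x, hx, rfl⟩ ε hε
    refine ⟨_, hK.unc x hx (fun i => ε (σ.symm i)) (fun i => hε _), ?_⟩
    ext i; simp [permL_apply]
  · rintro _ ⟨x, hx, rfl⟩ i
    exact hK.le1 x hx _
  · intro i
    refine ⟨_, hK.basis (σ i), ?_⟩
    ext j; simp [permL_apply, Pi.single_apply]

theorem mem_perm {n : ℕ} {K : Set (Fin n → ℝ)} (σ : Equiv.Perm (Fin n)) (y : Fin n → ℝ) :
    y ∈ permL σ '' K ↔ (fun i => y (σ.symm i)) ∈ K := by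
  constructor
  · rintro ⟨x, hx, rfl⟩
    simpa [permL_apply] using hx
  · intro h
    exact ⟨_, h, by ext i; simp [permL_apply]⟩

theorem ind_perm {n : ℕ} {K : Set (Fin n → ℝ)} (σ : Equiv.Perm (Fin n)) (T : List (Fin n)) :
    ind T ∈ permL σ '' K ↔ ind (T.map σ) ∈ K := by
  rw [mem_perm]
  have : (fun i => ind T (σ.symm i)) = ind (T.map σ) := by
    ext i
    simp only [ind, List.mem_map]
    congr 1
    apply propext
    constructor
    · intro h; exact ⟨_, h, by simp⟩
    · rintro ⟨a, ha, rfl⟩; simpa using ha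
  rw [this]

theorem nonbad_perm {n : ℕ} {K : Set (Fin n → ℝ)} (σ : Equiv.Perm (Fin n)) {i j k : Fin n}
    (h : Nonbad K (σ i) (σ j) (σ k)) : Nonbad (permL σ '' K) i j k := by
  rintro _ ⟨x, hx, rfl⟩ h1
  obtain ⟨y, hy, h2, h3⟩ := h x hx h1
  exact ⟨permL σ y, ⟨y, hy, rfl⟩, h2, h3⟩

theorem nonbad_symm {n : ℕ} {K : Set (Fin n → ℝ)} {i j k : Fin n}
    (h : Nonbad K i j k) : Nonbad K i k j := by
  intro x hx h1
  obtain ⟨y, hy, h2, h3⟩ := h x hx h1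
  exact ⟨y, hy, h3, h2⟩

theorem ind_of {n : ℕ} {K : Set (Fin n → ℝ)} (hK : Nrm K) (T : List (Fin n)) {x : Fin n → ℝ} (hx : x ∈ K)
    (h : ∀ i ∈ T, 1 ≤ |x i|) : ind T ∈ K := by
  apply down hK.conv hK.unc hx
  intro i
  unfold ind
  split_ifs with hi
  · simpa using h i hi
  · simp

theorem nonbad_mix {n : ℕ} {K : Set (Fin n → ℝ)} (hK : Nrm K) {i j k : Fin n} (hik' : i ≠ k)
    {x : Fin n → ℝ} (hx : x ∈ K) (hxi : |x i| = 1) (hxk : |x k| < 1) {c d : ℝ} (hc : c < 1) (hd : d ≤ |x k|) :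
    ∃ y ∈ K, c < y i ∧ d < y k := by
  have habs : (fun i => |x i|) ∈ K := down hK.conv hK.unc hx (fun i => by simp)
  obtain ⟨t, ht0, ht1⟩ : ∃ t : ℝ, 0 < t ∧ t < min 1 (1 - c) :=
    exists_between (lt_min one_pos (by linarith))
  rw [lt_min_iff] at ht1
  refine ⟨_, hK.conv habs (hK.basis k) (a := 1 - t) (b := t) (by linarith) ht0.le (by ring), ?_, ?_⟩
  · simp [hxi, hik']; linarith
  · simp
    nlinarith

theorem nonbad_or {n : ℕ} {K : Set (Fin n → ℝ)} (hK : Nrm K) {i j k : Fin n} (hik' : i ≠ k) (hjk' : j ≠ k)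
    (hij : ind [i, j] ∉ K) (hik : ind [i, k] ∉ K) (hjk : ind [j, k] ∉ K) :
    Nonbad K i j k ∨ Nonbad K j i k := by
  by_contra hcon
  push Not at hcon
  obtain ⟨h1, h2⟩ := hcon
  unfold Nonbad at h1 h2
  push Not at h1 h2
  obtain ⟨x, hx, hxi, hx2⟩ := h1
  obtain ⟨z, hz, hzj, hz2⟩ := h2
  have lt1 : ∀ a b : Fin n, ind [a, b] ∉ K → ∀ w ∈ K, |w a| = 1 → |w b| < 1 := by
    intro a b hab w hw hwa
    by_contra h; push Not at h
    refine hab (ind_of hK _ hw ?_)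
    intro i hi
    simp only [List.mem_cons, List.not_mem_nil, or_false] at hi
    rcases hi with rfl | rfl
    · exact hwa.ge
    · exact h
  have hij2 : ind [j, i] ∉ K := by
    have : ind [j, i] = ind [i, j] := by ext a; simp [ind, or_comm]
    rwa [this]
  rcases le_total (|z k|) (|x k|) with h | h
  · obtain ⟨y, hy, h3, h4⟩ := nonbad_mix hK (j := j) hik' hx hxi (lt1 i k hik x hx hxi) (lt1 j i hij2 z hz hzj) h
    have := hz2 y hy h3; linarith
  · obtain ⟨y, hy, h3, h4⟩ := nonbad_mix hK (j := i) hjk' hz hzj (lt1 j k hjk z hz hzj) (lt1 i j hij x hx hxi) h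
    have := hx2 y hy h3; linarith

end Ill

namespace Ill

theorem ind_nil_mem {n : ℕ} {K : Set (Fin n → ℝ)} (hK : Nrm K) : ind [] ∈ K := by
  obtain ⟨a, ha⟩ := hK.int
  exact ind_of hK [] (interior_subset ha) (by simp)

theorem ind_one_mem {n : ℕ} {K : Set (Fin n → ℝ)} (hK : Nrm K) (i : Fin n) : ind [i] ∈ K :=
  ind_of hK [i] (hK.basis i) (by simp)

/-- no triples in the complex -/
def NoTriple (K : Set (Fin 4 → ℝ)) : Prop :=
  ∀ i j k : Fin 4, i ≠ j → i ≠ k → j ≠ k → ind [i, j, k] ∉ K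

/-- the list of pairs -/
abbrev prs4 : List (List (Fin 4)) := [[0, 1], [0, 2], [0, 3], [1, 2], [1, 3], [2, 3]]
/-- the list of pairs -/
abbrev prs3 : List (List (Fin 3)) := [[0, 1], [0, 2], [1, 2]]

theorem hfs4 {K : Set (Fin 4 → ℝ)} (hK : Nrm K) (h3 : NoTriple K) (E : List (List (Fin 4)))
    (hE : ∀ T ∈ E, T ∈ prs4) (hG : ∀ T ∈ prs4, ind T ∈ K ↔ T ∈ E) :
    ∀ T ∈ subs [0, 1, 2, 3], ind T ∈ K ↔ T ∈ [[], [0], [1], [2], [3]] ++ E := by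
  have hfull : ind [0, 1, 2, 3] ∉ K := by
    intro h
    refine h3 0 1 2 (by decide) (by decide) (by decide) (ind_of hK _ h ?_)
    intro i hi
    have : i ∈ [0, 1, 2, 3] := by revert i; decide
    simp [ind, this]
  have hP : ∀ T ∈ prs4, ind T ∈ K ↔ T ∈ [[], [0], [1], [2], [3]] ++ E := by
    intro T hT
    rw [hG T hT, List.mem_append]
    refine ⟨Or.inr, fun h => h.resolve_left ?_⟩
    clear h
    revert T; decide
  have hN : ∀ T ∈ [[0, 1, 2, 3], [0, 1, 2], [0, 1, 3], [0, 2, 3], [1, 2, 3]], ind T ∉ K →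
      (ind T ∈ K ↔ T ∈ [[], [0], [1], [2], [3]] ++ E) := by
    intro T hT hn
    refine ⟨fun h => absurd h hn, fun h => ?_⟩
    rcases List.mem_append.1 h with h' | h'
    · clear h hn
      exfalso; revert T; decide
    · have := hE T h'
      clear h hn h'
      exfalso; revert T; decide
  intro T hT
  have hT' : T ∈ [[], [0], [1], [2], [3]] ∨ T ∈ prs4 ∨ T ∈ [[0, 1, 2, 3], [0, 1, 2], [0, 1, 3], [0, 2, 3], [1, 2, 3]] := by
    revert T; decide
  rcases hT' with h | h | h
  · refine ⟨fun _ => List.mem_append_left _ h, fun _ => ?_⟩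
    simp only [List.mem_cons, List.not_mem_nil, or_false] at h
    rcases h with rfl | rfl | rfl | rfl | rfl
    · exact ind_nil_mem hK
    all_goals exact ind_one_mem hK _
  · exact hP T h
  · refine hN T h ?_
    simp only [List.mem_cons, List.not_mem_nil, or_false] at h
    rcases h with rfl | rfl | rfl | rfl | rfl
    · exact hfull
    all_goals exact h3 _ _ _ (by decide) (by decide) (by decide)

theorem hfs3 {K : Set (Fin 3 → ℝ)} (hK : Nrm K) (h3 : ind [0, 1, 2] ∉ K) (E : List (List (Fin 3)))
    (hE : ∀ T ∈ E, T ∈ prs3) (hG : ∀ T ∈ prs3, ind T ∈ K ↔ T ∈ E) :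
    ∀ T ∈ subs [0, 1, 2], ind T ∈ K ↔ T ∈ [[], [0], [1], [2]] ++ E := by
  have hP : ∀ T ∈ prs3, ind T ∈ K ↔ T ∈ [[], [0], [1], [2]] ++ E := by
    intro T hT
    rw [hG T hT, List.mem_append]
    refine ⟨Or.inr, fun h => h.resolve_left ?_⟩
    clear h
    revert T; decide
  intro T hT
  have hT' : T ∈ [[], [0], [1], [2]] ∨ T ∈ prs3 ∨ T = [0, 1, 2] := by
    revert T; decide
  rcases hT' with h | h | h
  · refine ⟨fun _ => List.mem_append_left _ h, fun _ => ?_⟩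
    simp only [List.mem_cons, List.not_mem_nil, or_false] at h
    rcases h with rfl | rfl | rfl | rfl
    · exact ind_nil_mem hK
    all_goals exact ind_one_mem hK _
  · exact hP T h
  · subst h
    refine ⟨fun h => absurd h h3, fun h => ?_⟩
    rcases List.mem_append.1 h with h | h
    · exact absurd h (by decide)
    · exact absurd (hE _ h) (by decide)

theorem ix4 : ∀ i : Fin 4, i ∈ ([0, 1, 2, 3] : List (Fin 4)) := by decide
theorem ix3 : ∀ i : Fin 3, i ∈ ([0, 1, 2] : List (Fin 3)) := by decide

theorem good_g4 {K : Set (Fin 4 → ℝ)} (hK : Nrm K) (h3 : NoTriple K) (E : List (List (Fin 4)))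
    (hE : ∀ T ∈ E, T ∈ prs4) (hG : ∀ T ∈ prs4, ind T ∈ K ↔ T ∈ E)
    (nb : List (Fin 4 × Fin 4 × Fin 4)) (fls : List (Flag 4)) (hlen : fls.length ≤ 7)
    (hch : check [0, 1, 2, 3] ([[], [0], [1], [2], [3]] ++ E) nb (fls ++ fls.map negf) (fun _ _ _ => false) = true)
    (hnb : ∀ t ∈ nb, Nonbad K t.1 t.2.1 t.2.2) : Good K := by
  refine good_of_check (by norm_num) hK [0, 1, 2, 3] ix4 _ nb fls (by norm_num; omega) hch
    (hfs4 hK h3 E hE hG) ?_ hnb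
  intro T hT
  rcases List.mem_append.1 hT with h | h
  · clear hT
    revert T; decide
  · have := hE T h
    clear hT h
    revert T; decide

theorem good_g3 {K : Set (Fin 3 → ℝ)} (hK : Nrm K) (h3 : ind [0, 1, 2] ∉ K) (E : List (List (Fin 3)))
    (hE : ∀ T ∈ E, T ∈ prs3) (hG : ∀ T ∈ prs3, ind T ∈ K ↔ T ∈ E)
    (nb : List (Fin 3 × Fin 3 × Fin 3)) (fls : List (Flag 3)) (hlen : fls.length ≤ 3)
    (hch : check [0, 1, 2] ([[], [0], [1], [2]] ++ E) nb (fls ++ fls.map negf) (fun _ _ _ => false) = true)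
    (hnb : ∀ t ∈ nb, Nonbad K t.1 t.2.1 t.2.2) : Good K := by
  refine good_of_check (by norm_num) hK [0, 1, 2] ix3 _ nb fls (by norm_num; omega) hch
    (hfs3 hK h3 E hE hG) ?_ hnb
  intro T hT
  rcases List.mem_append.1 hT with h | h
  · clear hT
    revert T; decide
  · have := hE T h
    clear hT h
    revert T; decide

/-- edges -/
abbrev E4_empty : List (List (Fin 4)) := []
theorem g4_empty {K : Set (Fin 4 → ℝ)} (hK : Nrm K) (h3 : NoTriple K)
    (hG : ∀ T ∈ prs4, ind T ∈ K ↔ T ∈ E4_empty)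
    (b0 : Nonbad K 3 0 2)
    (b1 : Nonbad K 2 1 3) : Good K := by
  refine good_g4 hK h3 E4_empty (by decide) hG [(3, 0, 2), (2, 1, 3)]
    [![(true, 2), (true, 1), (true, 3), (true, 0)],
     ![(true, 2), (true, 0), (true, 3), (false, 1)],
     ![(true, 1), (false, 2), (true, 0), (true, 3)],
     ![(true, 0), (false, 2), (false, 1), (true, 3)],
     ![(true, 0), (true, 1), (true, 2), (true, 3)],
     ![(true, 0), (false, 1), (true, 2), (true, 3)]] (by decide) (by decide +kernel) ?_
  simp only [List.mem_cons, List.not_mem_nil, or_false]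
  rintro t (rfl | rfl)
  · exact b0
  · exact b1

/-- edges -/
abbrev E4_edgeA : List (List (Fin 4)) := [[0, 1]]
theorem g4_edgeA {K : Set (Fin 4 → ℝ)} (hK : Nrm K) (h3 : NoTriple K)
    (hG : ∀ T ∈ prs4, ind T ∈ K ↔ T ∈ E4_edgeA)
    (b0 : Nonbad K 0 2 3) : Good K := by
  refine good_g4 hK h3 E4_edgeA (by decide) hG [(0, 2, 3)]
    [![(true, 0), (true, 1), (true, 2), (true, 3)],
     ![(true, 1), (false, 0), (true, 2), (true, 3)],
     ![(true, 2), (true, 3), (true, 1), (true, 0)],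
     ![(true, 2), (true, 3), (true, 0), (false, 1)],
     ![(true, 2), (true, 0), (false, 1), (true, 3)]] (by decide) (by decide +kernel) ?_
  simp only [List.mem_cons, List.not_mem_nil, or_false]
  rintro t (rfl)
  · exact b0

/-- edges -/
abbrev E4_edgeB : List (List (Fin 4)) := [[0, 1]]
theorem g4_edgeB {K : Set (Fin 4 → ℝ)} (hK : Nrm K) (h3 : NoTriple K)
    (hG : ∀ T ∈ prs4, ind T ∈ K ↔ T ∈ E4_edgeB)
    (b0 : Nonbad K 3 0 2)
    (b1 : Nonbad K 2 1 3) : Good K := by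
  refine good_g4 hK h3 E4_edgeB (by decide) hG [(3, 0, 2), (2, 1, 3)]
    [![(true, 0), (true, 1), (true, 2), (true, 3)],
     ![(true, 1), (false, 0), (true, 2), (true, 3)],
     ![(true, 2), (true, 3), (false, 1), (false, 0)],
     ![(true, 2), (true, 3), (false, 0), (true, 1)],
     ![(true, 2), (false, 0), (false, 1), (true, 3)],
     ![(true, 0), (true, 2), (true, 1), (true, 3)]] (by decide) (by decide +kernel) ?_
  simp only [List.mem_cons, List.not_mem_nil, or_false]
  rintro t (rfl | rfl)
  · exact b0
  · exact b1

/-- edges -/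
abbrev E4_matching : List (List (Fin 4)) := [[0, 1], [2, 3]]
theorem g4_matching {K : Set (Fin 4 → ℝ)} (hK : Nrm K) (h3 : NoTriple K)
    (hG : ∀ T ∈ prs4, ind T ∈ K ↔ T ∈ E4_matching) : Good K := by
  refine good_g4 hK h3 E4_matching (by decide) hG []
    [![(true, 2), (true, 3), (true, 0), (true, 1)],
     ![(true, 2), (true, 3), (true, 1), (false, 0)],
     ![(true, 0), (true, 1), (true, 2), (true, 3)],
     ![(true, 1), (false, 0), (true, 2), (true, 3)]] (by decide) (by decide +kernel) ?_
  simp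

/-- edges -/
abbrev E4_cherry : List (List (Fin 4)) := [[0, 1], [1, 2]]
theorem g4_cherry {K : Set (Fin 4 → ℝ)} (hK : Nrm K) (h3 : NoTriple K)
    (hG : ∀ T ∈ prs4, ind T ∈ K ↔ T ∈ E4_cherry)
    (b0 : Nonbad K 0 2 3) : Good K := by
  refine good_g4 hK h3 E4_cherry (by decide) hG [(0, 2, 3)]
    [![(true, 2), (true, 1), (true, 0), (true, 3)],
     ![(true, 2), (true, 0), (false, 1), (true, 3)],
     ![(true, 1), (false, 2), (true, 3), (true, 0)],
     ![(true, 0), (false, 2), (true, 3), (false, 1)],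
     ![(true, 0), (true, 1), (true, 2), (true, 3)],
     ![(true, 0), (false, 2), (false, 1), (true, 3)]] (by decide) (by decide +kernel) ?_
  simp only [List.mem_cons, List.not_mem_nil, or_false]
  rintro t (rfl)
  · exact b0

/-- edges -/
abbrev E4_path : List (List (Fin 4)) := [[0, 1], [1, 2], [2, 3]]
theorem g4_path {K : Set (Fin 4 → ℝ)} (hK : Nrm K) (h3 : NoTriple K)
    (hG : ∀ T ∈ prs4, ind T ∈ K ↔ T ∈ E4_path) : Good K := by
  refine good_g4 hK h3 E4_path (by decide) hG []
    [![(true, 3), (true, 2), (true, 1), (true, 0)],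
     ![(true, 2), (true, 3), (true, 0), (false, 1)],
     ![(true, 0), (true, 1), (false, 2), (true, 3)],
     ![(true, 1), (false, 0), (true, 2), (true, 3)],
     ![(true, 2), (true, 0), (true, 1), (true, 3)],
     ![(true, 2), (true, 0), (false, 1), (true, 3)]] (by decide) (by decide +kernel) ?_
  simp

/-- edges -/
abbrev E4_tri : List (List (Fin 4)) := [[0, 1], [1, 2], [0, 2]]
theorem g4_tri {K : Set (Fin 4 → ℝ)} (hK : Nrm K) (h3 : NoTriple K)
    (hG : ∀ T ∈ prs4, ind T ∈ K ↔ T ∈ E4_tri) : Good K := by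
  refine good_g4 hK h3 E4_tri (by decide) hG []
    [![(true, 1), (true, 0), (true, 2), (true, 3)],
     ![(true, 1), (true, 2), (false, 0), (true, 3)],
     ![(true, 0), (false, 1), (true, 2), (true, 3)],
     ![(true, 2), (false, 3), (false, 1), (false, 0)],
     ![(true, 2), (false, 3), (false, 1), (true, 0)],
     ![(true, 2), (true, 0), (false, 1), (true, 3)],
     ![(true, 0), (true, 2), (true, 1), (true, 3)]] (by decide) (by decide +kernel) ?_
  simp

/-- edges -/
abbrev E4_star : List (List (Fin 4)) := [[0, 1], [0, 2], [0, 3]]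
theorem g4_star {K : Set (Fin 4 → ℝ)} (hK : Nrm K) (h3 : NoTriple K)
    (hG : ∀ T ∈ prs4, ind T ∈ K ↔ T ∈ E4_star) : Good K := by
  refine good_g4 hK h3 E4_star (by decide) hG []
    [![(true, 2), (true, 0), (true, 1), (true, 3)],
     ![(true, 2), (true, 3), (false, 1), (true, 0)],
     ![(true, 2), (true, 1), (false, 0), (false, 3)],
     ![(true, 0), (false, 3), (false, 2), (false, 1)],
     ![(true, 0), (false, 3), (true, 1), (false, 2)],
     ![(true, 0), (false, 1), (true, 3), (true, 2)],
     ![(true, 0), (true, 1), (true, 3), (true, 2)]] (by decide) (by decide +kernel) ?_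
  simp

/-- edges -/
abbrev E4_paw : List (List (Fin 4)) := [[0, 1], [1, 2], [0, 2], [2, 3]]
theorem g4_paw {K : Set (Fin 4 → ℝ)} (hK : Nrm K) (h3 : NoTriple K)
    (hG : ∀ T ∈ prs4, ind T ∈ K ↔ T ∈ E4_paw) : Good K := by
  refine good_g4 hK h3 E4_paw (by decide) hG []
    [![(true, 0), (true, 1), (true, 2), (true, 3)],
     ![(true, 1), (false, 0), (true, 2), (true, 3)],
     ![(true, 2), (true, 3), (false, 1), (false, 0)],
     ![(true, 2), (true, 3), (false, 0), (true, 1)],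
     ![(true, 2), (false, 1), (false, 0), (true, 3)],
     ![(true, 0), (true, 2), (true, 1), (true, 3)]] (by decide) (by decide +kernel) ?_
  simp

/-- edges -/
abbrev E4_diam : List (List (Fin 4)) := [[0, 1], [0, 2], [0, 3], [1, 2], [1, 3]]
theorem g4_diam {K : Set (Fin 4 → ℝ)} (hK : Nrm K) (h3 : NoTriple K)
    (hG : ∀ T ∈ prs4, ind T ∈ K ↔ T ∈ E4_diam) : Good K := by
  refine good_g4 hK h3 E4_diam (by decide) hG []
    [![(true, 1), (true, 2), (true, 3), (true, 0)],
     ![(true, 0), (true, 2), (true, 3), (false, 1)],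
     ![(true, 2), (false, 1), (true, 0), (true, 3)],
     ![(true, 2), (false, 0), (false, 1), (true, 3)],
     ![(true, 0), (true, 2), (false, 1), (true, 3)],
     ![(true, 1), (false, 0), (true, 3), (true, 2)],
     ![(true, 2), (true, 0), (true, 3), (true, 1)]] (by decide) (by decide +kernel) ?_
  simp

/-- edges -/
abbrev E4_full : List (List (Fin 4)) := [[0, 1], [0, 2], [0, 3], [1, 2], [1, 3], [2, 3]]
theorem g4_full {K : Set (Fin 4 → ℝ)} (hK : Nrm K) (h3 : NoTriple K)
    (hG : ∀ T ∈ prs4, ind T ∈ K ↔ T ∈ E4_full) : Good K := by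
  refine good_g4 hK h3 E4_full (by decide) hG []
    [![(true, 2), (true, 0), (true, 1), (true, 3)],
     ![(true, 2), (false, 1), (true, 3), (true, 0)],
     ![(true, 2), (true, 3), (false, 0), (true, 1)],
     ![(true, 0), (false, 3), (true, 2), (false, 1)],
     ![(true, 0), (false, 2), (true, 1), (true, 3)],
     ![(true, 0), (true, 2), (false, 1), (false, 3)],
     ![(true, 0), (true, 1), (true, 2), (true, 3)]] (by decide) (by decide +kernel) ?_
  simp

/-- edges -/
abbrev E3_empty : List (List (Fin 3)) := []
theorem g3_empty {K : Set (Fin 3 → ℝ)} (hK : Nrm K) (h3 : ind [0, 1, 2] ∉ K)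
    (hG : ∀ T ∈ prs3, ind T ∈ K ↔ T ∈ E3_empty)
    (b0 : Nonbad K 2 0 1) : Good K := by
  refine good_g3 hK h3 E3_empty (by decide) hG [(2, 0, 1)]
    [![(true, 1), (true, 2), (true, 0)],
     ![(true, 1), (false, 0), (true, 2)],
     ![(true, 0), (true, 1), (true, 2)]] (by decide) (by decide +kernel) ?_
  simp only [List.mem_cons, List.not_mem_nil, or_false]
  rintro t (rfl)
  · exact b0

/-- edges -/
abbrev E3_edge : List (List (Fin 3)) := [[0, 1]]
theorem g3_edge {K : Set (Fin 3 → ℝ)} (hK : Nrm K) (h3 : ind [0, 1, 2] ∉ K)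
    (hG : ∀ T ∈ prs3, ind T ∈ K ↔ T ∈ E3_edge) : Good K := by
  refine good_g3 hK h3 E3_edge (by decide) hG []
    [![(true, 1), (true, 2), (true, 0)],
     ![(true, 0), (true, 1), (true, 2)],
     ![(true, 1), (false, 0), (true, 2)]] (by decide) (by decide +kernel) ?_
  simp

/-- edges -/
abbrev E3_tri : List (List (Fin 3)) := [[0, 1], [0, 2], [1, 2]]
theorem g3_tri {K : Set (Fin 3 → ℝ)} (hK : Nrm K) (h3 : ind [0, 1, 2] ∉ K)
    (hG : ∀ T ∈ prs3, ind T ∈ K ↔ T ∈ E3_tri) : Good K := by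
  refine good_g3 hK h3 E3_tri (by decide) hG []
    [![(true, 1), (true, 0), (true, 2)],
     ![(true, 1), (true, 2), (false, 0)],
     ![(true, 0), (false, 1), (true, 2)]] (by decide) (by decide +kernel) ?_
  simp

end Ill

namespace Ill
open Filter Topology

theorem mem_cube {n : ℕ} (x : Fin n → ℝ) :
    x ∈ Set.Icc (fun _ => (-1 : ℝ)) (fun _ => 1) ↔ ∀ i, |x i| ≤ 1 := by
  rw [Set.mem_Icc, Pi.le_def, Pi.le_def]
  constructor
  · intro h i; exact abs_le.2 ⟨h.1 i, h.2 i⟩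
  · intro h; exact ⟨fun i => (abs_le.1 (h i)).1, fun i => (abs_le.1 (h i)).2⟩

theorem par_cube {n : ℕ} {K : Set (Fin n → ℝ)} (h : ∀ x, x ∈ K ↔ ∀ i, |x i| ≤ 1) : IsParallelepiped K := by
  refine ⟨AffineEquiv.refl ℝ _, ?_⟩
  ext x
  rw [h]
  simp only [AffineEquiv.coe_refl, Set.image_id, mem_cube]

theorem par_full {n : ℕ} {K : Set (Fin n → ℝ)} (hK : Nrm K) {w : Fin n → ℝ} (hw : w ∈ K) (hw1 : ∀ i, 1 ≤ |w i|) :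
    IsParallelepiped K :=
  par_cube fun x => ⟨fun hx i => hK.le1 x hx i, fun h => down hK.conv hK.unc hw
    (fun i => (h i).trans (hw1 i))⟩

/-- rotation in the plane `p, q` -/
noncomputable def rotL {n : ℕ} (p q : Fin n) (hpq : p ≠ q) : (Fin n → ℝ) ≃L[ℝ] (Fin n → ℝ) :=
  LinearEquiv.toContinuousLinearEquiv
    { toFun := fun x i => if i = p then x p + x q else if i = q then x p - x q else x i
      invFun := fun x i => if i = p then (x p + x q) / 2 else if i = q then (x p - x q) / 2 else x i
      map_add' := fun x y => by
        ext i; simp only [Pi.add_apply]; split_ifs <;> ring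
      map_smul' := fun c x => by
        ext i; simp only [Pi.smul_apply, smul_eq_mul, RingHom.id_apply]; split_ifs <;> ring
      left_inv := fun x => by
        ext i
        by_cases h1 : i = p
        · subst h1; simp [hpq.symm]
        · by_cases h2 : i = q
          · subst h2; simp [h1]
          · simp [h1, h2]
      right_inv := fun x => by
        ext i
        by_cases h1 : i = p
        · subst h1; simp [hpq.symm]; ring
        · by_cases h2 : i = q
          · subst h2; simp [h1]; ring
          · simp [h1, h2] }

theorem rotL_apply {n : ℕ} (p q : Fin n) (hpq : p ≠ q) (x : Fin n → ℝ) (i : Fin n) :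
    rotL p q hpq x i = if i = p then x p + x q else if i = q then x p - x q else x i := rfl
theorem rotL_symm_apply {n : ℕ} (p q : Fin n) (hpq : p ≠ q) (x : Fin n → ℝ) (i : Fin n) :
    (rotL p q hpq).symm x i = if i = p then (x p + x q) / 2 else if i = q then (x p - x q) / 2 else x i := rfl

theorem mem_image_L {n : ℕ} {K : Set (Fin n → ℝ)} (L : (Fin n → ℝ) ≃L[ℝ] (Fin n → ℝ)) (y : Fin n → ℝ) :
    y ∈ L '' K ↔ L.symm y ∈ K := by
  constructor
  · rintro ⟨x, hx, rfl⟩; simpa using hx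
  · intro h; exact ⟨_, h, by simp⟩

theorem abs_rot (a b : ℝ) : |(a + b) / 2| + |(a - b) / 2| ≤ 1 ↔ |a| ≤ 1 ∧ |b| ≤ 1 := by
  constructor
  · intro h
    have h1 := abs_le.1 (le_refl |(a + b) / 2|)
    have h2 := abs_le.1 (le_refl |(a - b) / 2|)
    constructor <;> rw [abs_le] <;> constructor <;> linarith [h1.1, h1.2, h2.1, h2.2]
  · rintro ⟨h1, h2⟩
    rw [abs_le] at h1 h2
    rcases abs_cases ((a + b) / 2) with ⟨e1, _⟩ | ⟨e1, _⟩ <;>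
    rcases abs_cases ((a - b) / 2) with ⟨e2, _⟩ | ⟨e2, _⟩ <;> rw [e1, e2] <;> linarith [h1.1, h1.2, h2.1, h2.2]

theorem rot_cond {n : ℕ} (p q : Fin n) (hpq : p ≠ q) (y : Fin n → ℝ) :
    |(rotL p q hpq).symm y p| + |(rotL p q hpq).symm y q| ≤ 1 ↔ |y p| ≤ 1 ∧ |y q| ≤ 1 := by
  rw [rotL_symm_apply, rotL_symm_apply, if_pos rfl, if_neg hpq.symm, if_pos rfl, abs_rot]

theorem par_rot {n : ℕ} {K : Set (Fin n → ℝ)} (p q : Fin n) (hpq : p ≠ q)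
    (h : ∀ x, x ∈ K ↔ (|x p| + |x q| ≤ 1 ∧ ∀ i, i ≠ p → i ≠ q → |x i| ≤ 1)) : IsParallelepiped K := by
  apply par_image (rotL p q hpq)
  apply par_cube
  intro y
  rw [mem_image_L, h, rot_cond]
  constructor
  · rintro ⟨⟨h1, h2⟩, h3⟩ i
    by_cases hp : i = p
    · rw [hp]; exact h1
    · by_cases hq : i = q
      · rw [hq]; exact h2
      · have := h3 i hp hq
        rwa [rotL_symm_apply, if_neg hp, if_neg hq] at this
  · intro h1
    refine ⟨⟨h1 _, h1 _⟩, fun i hp hq => ?_⟩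
    rw [rotL_symm_apply, if_neg hp, if_neg hq]; exact h1 i

theorem par_path3 {K : Set (Fin 3 → ℝ)} (hK : Nrm K) (h01 : ind [0, 1] ∈ K) (h02 : ind [0, 2] ∈ K)
    (h : ∀ z ∈ K, |z 1| + |z 2| ≤ 1) : IsParallelepiped K := by
  refine par_rot 1 2 (by decide) fun x => ⟨fun hx => ⟨h x hx, fun i _ _ => hK.le1 x hx i⟩, ?_⟩
  rintro ⟨h1, h2⟩
  have h0 := h2 0 (by decide) (by decide)
  have := hK.conv h01 h02 (a := |x 1|) (b := 1 - |x 1|) (abs_nonneg _)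
    (by linarith [abs_nonneg (x 2)]) (by ring)
  refine down hK.conv hK.unc this ?_
  intro i
  fin_cases i
  · simpa [ind] using h0
  · simp [ind]
  · simp [ind]
    exact le_trans (by linarith) (le_abs_self _)

theorem fin4_cases : ∀ i j k l : Fin 4, i ≠ j → i ≠ k → j ≠ k → i ≠ 3 → j ≠ 3 → k ≠ 3 →
    l = i ∨ l = j ∨ l = k ∨ l = 3 := by decide

theorem par_k3 {K : Set (Fin 4 → ℝ)} (hK : Nrm K) {i j k : Fin 4} (hij : i ≠ j) (hik : i ≠ k) (hjk : j ≠ k)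
    (hi3 : i ≠ 3) (hj3 : j ≠ 3) (hk3 : k ≠ 3)
    (h1 : ind [i, j, k] ∈ K) (h2 : ind [j, k, 3] ∈ K)
    (h : ∀ z ∈ K, |z i| + |z 3| ≤ 1) : IsParallelepiped K := by
  refine par_rot i 3 hi3 fun x => ⟨fun hx => ⟨h x hx, fun i _ _ => hK.le1 x hx i⟩, ?_⟩
  rintro ⟨h3, h4⟩
  have := hK.conv h1 h2 (a := |x i|) (b := 1 - |x i|) (abs_nonneg _)
    (by linarith [abs_nonneg (x 3)]) (by ring)
  refine down hK.conv hK.unc this ?_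
  intro l
  have hl : l = i ∨ l = j ∨ l = k ∨ l = 3 := fin4_cases i j k l hij hik hjk hi3 hj3 hk3
  rcases hl with rfl | rfl | rfl | rfl
  · simp [ind, hij, hik, hi3]
  · have := h4 l hij.symm hj3
    simpa [ind, hij.symm, hjk, hj3] using this
  · have := h4 l hik.symm hk3
    simpa [ind, hik.symm, hjk.symm, hk3] using this
  · simp [ind, hi3.symm, hj3.symm, hk3.symm]
    exact le_trans (by linarith) (le_abs_self _)

theorem par_c4 {K : Set (Fin 4 → ℝ)} (hK : Nrm K) (h02 : ind [0, 2] ∈ K) (h03 : ind [0, 3] ∈ K)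
    (h12 : ind [1, 2] ∈ K) (h13 : ind [1, 3] ∈ K)
    (h : ∀ z ∈ K, |z 0| + |z 1| ≤ 1) (h' : ∀ z ∈ K, |z 2| + |z 3| ≤ 1) : IsParallelepiped K := by
  have key : ∀ x : Fin 4 → ℝ, x ∈ K ↔ |x 0| + |x 1| ≤ 1 ∧ |x 2| + |x 3| ≤ 1 := by
    intro x
    refine ⟨fun hx => ⟨h x hx, h' x hx⟩, ?_⟩
    rintro ⟨h1, h2⟩
    have ha := hK.conv h02 h03 (a := |x 2|) (b := 1 - |x 2|) (abs_nonneg _)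
      (by linarith [abs_nonneg (x 3)]) (by ring)
    have hb := hK.conv h12 h13 (a := |x 2|) (b := 1 - |x 2|) (abs_nonneg _)
      (by linarith [abs_nonneg (x 3)]) (by ring)
    have hc := hK.conv ha hb (a := |x 0|) (b := 1 - |x 0|) (abs_nonneg _)
      (by linarith [abs_nonneg (x 1)]) (by ring)
    refine down hK.conv hK.unc hc ?_
    intro i
    refine le_trans ?_ (le_abs_self _)
    fin_cases i
    · simp [ind]; exact le_of_eq (by ring)
    · simp [ind]; linarith
    · simp [ind]; linarith
    · simp [ind]; linarith
  apply par_image (rotL 0 1 (by decide))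
  refine par_rot 2 3 (by decide) fun y => ?_
  rw [mem_image_L, key, rot_cond]
  have e2 : (rotL (0 : Fin 4) 1 (by decide)).symm y 2 = y 2 := by simp [rotL_symm_apply]
  have e3 : (rotL (0 : Fin 4) 1 (by decide)).symm y 3 = y 3 := by simp [rotL_symm_apply]
  rw [e2, e3]
  constructor
  · rintro ⟨⟨a, b⟩, c⟩
    refine ⟨c, fun i h2 h3 => ?_⟩
    have : i = 0 ∨ i = 1 := by revert i; decide
    rcases this with rfl | rfl <;> assumption
  · rintro ⟨c, d⟩
    exact ⟨⟨d 0 (by decide) (by decide), d 1 (by decide) (by decide)⟩, c⟩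

theorem gc_right {c x m : ℝ} (h : 0 < c * x) : gc c x m = |c| * m := if_pos h
theorem gc_ge {c x m : ℝ} (hm : 0 ≤ m) : -(|c| * m) ≤ gc c x m := by
  unfold gc
  have : 0 ≤ |c| * m := by positivity
  split_ifs <;> linarith

theorem path3_core {K : Set (Fin 3 → ℝ)} (hK : Nrm K) (i j : Fin 3) (hi : i ≠ 0) (hj : j ≠ 0) (hij : i ≠ j)
    (hs : ∀ f : Fin 3 → ℝ, ∑ l, f l = f 0 + f i + f j)
    (h0j : ind [0, j] ∈ K) (hnd : ¬ ∀ z ∈ K, |z i| + |z j| ≤ 1)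
    {x : Fin 3 → ℝ} (hx : x ∈ K) (hxj : x j = 0) (v : Fin 3 → ℝ) (hv0 : 0 < v 0 * x 0) (hvi : 0 < v i * x i)
    (hv1 : |v i| = 1) (hv2 : |v j| = 1) : Illuminates K (-v) x := by
  refine illum_of_adm hK hx _ fun μ hA => ?_
  rw [hs, gc_right hv0, gc_right hvi, hv1]
  have hj := gc_ge (c := v j) (x := x j) (hA.nn j)
  rw [hv2] at hj
  have hη : 0 < |v 0| := by
    rw [abs_pos]; rintro h; simp [h] at hv0
  have f2 := hA.le _ h0j
  rw [hs, hs] at f2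
  simp [ind, hi, hj, hij, hxj, hi.symm, hij.symm] at f2
  by_contra hcon
  push Not at hcon
  have n0 := hA.nn 0
  have ni := hA.nn i
  have nj := hA.nn j
  have a0 := hK.le1 x hx 0
  have ai := hK.le1 x hx i
  have p1 : μ 0 * |x 0| ≤ μ 0 := by nlinarith
  have p2 : μ i * |x i| ≤ μ i := by nlinarith
  have p3 : 0 ≤ |v 0| * μ 0 := by positivity
  have q1 : |v 0| * μ 0 = 0 := by linarith
  have q2 : μ 0 = 0 := by
    rcases mul_eq_zero.1 q1 with h | h
    · exact absurd h hη.ne'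
    · exact h
  have q3 : μ i = μ j := by linarith
  have hm : 0 < μ i := by
    rcases ni.lt_or_eq with h | h
    · exact h
    · exfalso
      apply hA.ne
      have hsum := hs μ
      have : ∑ l, μ l = 0 := by linarith
      ext l
      exact (Finset.sum_eq_zero_iff_of_nonneg (fun l _ => hA.nn l)).1 this l (Finset.mem_univ _)
  apply hnd
  intro z hz
  have := hA.le z hz
  rw [hs, hs, q2, ← q3, hxj] at this
  simp only [zero_mul, zero_add, abs_zero, mul_zero, add_zero] at this
  have h9 : μ i * (|z i| + |z j|) ≤ μ i * 1 := by nlinarith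
  exact le_of_mul_le_mul_left h9 hm

theorem dir_abs0 {n : ℕ} (f : Flag n) {η : ℝ} (hη : 0 < η) (i : Fin n) (h : (f i).2 = 0) : |dir η f i| = 1 := by
  rw [abs_dir f hη, h, pow_zero]

/-- main flag of the path -/
abbrev pA : Flag 3 := ![(true, 1), (true, 0), (true, 0)]
/-- special states -/
def spec3 (P N _H : List (Fin 3)) : Bool :=
  (el P 0 && ((el P 1 && (!el P 2 && !el N 2)) || (el P 2 && (!el P 1 && !el N 1)))) ||
  (el N 0 && ((el N 1 && (!el P 2 && !el N 2)) || (el N 2 && (!el P 1 && !el N 1))))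

/-- edges -/
abbrev E3_path : List (List (Fin 3)) := [[0, 1], [0, 2]]

theorem g3_path {K : Set (Fin 3 → ℝ)} (hK : Nrm K) (h3 : ind [0, 1, 2] ∉ K)
    (hG : ∀ T ∈ prs3, ind T ∈ K ↔ T ∈ E3_path) (hpar : ¬ IsParallelepiped K) : Good K := by
  have h01 : ind [0, 1] ∈ K := (hG _ (by decide)).2 (by decide)
  have h02 : ind [0, 2] ∈ K := (hG _ (by decide)).2 (by decide)
  have hnd : ¬ ∀ z ∈ K, |z 1| + |z 2| ≤ 1 := fun h => hpar (par_path3 hK h01 h02 h)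
  have hnd2 : ¬ ∀ z ∈ K, |z 2| + |z 1| ≤ 1 := fun h => hnd fun z hz => by linarith [h z hz]
  have hfs := hfs3 hK h3 E3_path (by decide) hG
  let fls : List (Flag 3) := [pA, ![(true, 2), (true, 1), (false, 0)], ![(true, 2), (false, 0), (true, 1)]]
  obtain ⟨κ, hk0, hk1, hk2, hk3⟩ := machine hK [0, 1, 2] ix3 ([[], [0], [1], [2]] ++ E3_path) []
    (fun T hT => (hfs T (by revert T; decide)).2 hT) (fun T hT h => (hfs T hT).1 h) (by simp)
  obtain ⟨η, hη, hη0, -⟩ := (hk3.and (ev_small 1 one_pos)).exists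
  refine good_of_flags (by norm_num) hK fls (by simp [fls]) hη0 fun x hx => ?_
  have hch : check [0, 1, 2] ([[], [0], [1], [2]] ++ E3_path) [] (fls ++ fls.map negf) spec3 = true := by
    decide +kernel
  have s1 : ∀ f : Fin 3 → ℝ, ∑ l, f l = f 0 + f 1 + f 2 := fun f => by rw [Fin.sum_univ_three]
  have s2 : ∀ f : Fin 3 → ℝ, ∑ l, f l = f 0 + f 2 + f 1 := fun f => by rw [Fin.sum_univ_three]; ring
  rcases check_use ix3 hch hk1 x (hk2 x hx) with ⟨f, hf, hi⟩ | h
  · exact ⟨f, hf, hη x hx f hi⟩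
  · have e0 : dir η pA 0 = η := by simp [dir]
    have e1 : dir η pA 1 = 1 := by simp [dir]
    have e2 : dir η pA 2 = 1 := by simp [dir]
    have hpos : ∀ t : ℝ, 0 < t → 0 < η * t := fun t ht => mul_pos hη0 ht
    simp only [spec3, Bool.or_eq_true, Bool.and_eq_true, Bool.not_eq_true', ← Bool.not_eq_true, el_iff,
      mem_psn ix3, mem_ngn ix3] at h
    rcases h with ⟨h0, ⟨h1, h2, h2'⟩ | ⟨h1, h2, h2'⟩⟩ | ⟨h0, ⟨h1, h2, h2'⟩ | ⟨h1, h2, h2'⟩⟩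
    · refine ⟨pA, by simp [fls], path3_core hK 1 2 (by decide) (by decide) (by decide) s1 h02 hnd hx
        (by linarith) _ ?_ ?_ ?_ ?_⟩
      · rw [e0]; exact hpos _ h0
      · rw [e1]; linarith
      · rw [e1]; simp
      · rw [e2]; simp
    · refine ⟨pA, by simp [fls], path3_core hK 2 1 (by decide) (by decide) (by decide) s2 h01 hnd2 hx
        (by linarith) _ ?_ ?_ ?_ ?_⟩
      · rw [e0]; exact hpos _ h0
      · rw [e2]; linarith
      · rw [e2]; simp
      · rw [e1]; simp
    · refine ⟨negf pA, by simp [fls], ?_⟩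
      rw [dir_negf]
      refine path3_core hK 1 2 (by decide) (by decide) (by decide) s1 h02 hnd hx
        (by linarith) _ ?_ ?_ ?_ ?_
      · rw [Pi.neg_apply, e0]; have := hpos (-x 0) (by linarith); linarith
      · rw [Pi.neg_apply, e1]; linarith
      · rw [Pi.neg_apply, e1]; simp
      · rw [Pi.neg_apply, e2]; simp
    · refine ⟨negf pA, by simp [fls], ?_⟩
      rw [dir_negf]
      refine path3_core hK 2 1 (by decide) (by decide) (by decide) s2 h01 hnd2 hx
        (by linarith) _ ?_ ?_ ?_ ?_
      · rw [Pi.neg_apply, e0]; have := hpos (-x 0) (by linarith); linarith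
      · rw [Pi.neg_apply, e2]; linarith
      · rw [Pi.neg_apply, e2]; simp
      · rw [Pi.neg_apply, e1]; simp

end Ill

namespace Ill
open Filter Topology

theorem adm_sum_zero {n : ℕ} {K : Set (Fin n → ℝ)} {x μ : Fin n → ℝ} (hA : Adm K x μ) (h : ∑ l, μ l ≤ 0) : False := by
  apply hA.ne
  have h0 : ∑ l, μ l = 0 := le_antisymm h (Finset.sum_nonneg fun l _ => hA.nn l)
  ext l
  exact (Finset.sum_eq_zero_iff_of_nonneg (fun l _ => hA.nn l)).1 h0 l (Finset.mem_univ _)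

theorem c4_core {K : Set (Fin 4 → ℝ)} (hK : Nrm K) (p q r u : Fin 4)
    (hd : [p, q, r, u].Nodup)
    (hs : ∀ f : Fin 4 → ℝ, ∑ l, f l = f p + f q + f r + f u)
    (hqu : ind [q, u] ∈ K) (hqr : ind [q, r] ∈ K) (hnd : ¬ ∀ z ∈ K, |z p| + |z q| ≤ 1)
    {κ η : ℝ} (hηκ : η < κ)
    {x : Fin 4 → ℝ} (hx : x ∈ K) (hxq : x q = 0) (hxu : |x u| ≤ 1 - κ)
    (v : Fin 4 → ℝ) (hvp : 0 < v p * x p) (hvr : 0 < v r * x r)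
    (hv1 : |v p| = 1) (hv2 : |v q| = 1) (hv3 : |v r| = 1) (hv4 : |v u| = η) : Illuminates K (-v) x := by
  refine illum_of_adm hK hx _ fun μ hA => ?_
  rw [hs, gc_right hvp, gc_right hvr, hv1, hv3]
  have gq := gc_ge (c := v q) (x := x q) (hA.nn q)
  have gu := gc_ge (c := v u) (x := x u) (hA.nn u)
  rw [hv2] at gq
  rw [hv4] at gu
  simp only [List.nodup_cons, List.mem_cons, List.not_mem_nil, or_false, not_or, not_false_eq_true,
    List.nodup_nil, and_true] at hd
  obtain ⟨⟨pq, pr, pu⟩, ⟨qr, qu⟩, ru⟩ := hd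
  have f1 := hA.le _ hqu
  have f2 := hA.le _ hqr
  rw [hs, hs] at f1 f2
  simp [ind, pq, pr, pu, qr, qu, ru, hxq, Ne.symm qr, Ne.symm qu, Ne.symm ru] at f1 f2
  by_contra hcon
  push Not at hcon
  have np := hA.nn p
  have nq := hA.nn q
  have nr := hA.nn r
  have nu := hA.nn u
  have ap := hK.le1 x hx p
  have ar := hK.le1 x hx r
  have p1 : μ p * |x p| ≤ μ p := by nlinarith
  have p2 : μ r * |x r| ≤ μ r := by nlinarith
  have p3 : μ u * |x u| ≤ μ u * (1 - κ) := by gcongr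
  have q1 : (κ - η) * μ u ≤ 0 := by linarith
  have q2 : μ u = 0 := by
    refine le_antisymm ?_ nu
    by_contra hc; push Not at hc
    have := mul_pos (sub_pos.2 hηκ) hc
    linarith
  rw [q2] at f1 f2 hcon gu
  simp only [mul_zero, zero_mul, neg_zero] at f1 f2 gu
  have q3 : μ r = 0 := by linarith
  have q4 : μ p = μ q := by linarith
  have hm : 0 < μ p := by
    rcases np.lt_or_eq with h | h
    · exact h
    · exfalso
      refine adm_sum_zero hA ?_
      rw [hs]; linarith
  apply hnd
  intro z hz
  have := hA.le z hz
  rw [hs, hs, q2, q3, ← q4, hxq] at this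
  simp only [zero_mul, abs_zero, mul_zero, add_zero] at this
  have h9 : μ p * (|z p| + |z q|) ≤ μ p * 1 := by nlinarith
  exact le_of_mul_le_mul_left h9 hm

/-- special flags -/
abbrev cA : Flag 4 := ![(true, 0), (true, 0), (true, 0), (true, 1)]
/-- special flags -/
abbrev cB : Flag 4 := ![(true, 0), (true, 0), (true, 1), (false, 0)]
/-- special states, half -/
def spec4h (P N H : List (Fin 4)) : Bool :=
  ((el P 0 && (!el P 1 && !el N 1)) || (el P 1 && (!el P 0 && !el N 0))) &&
    ((el P 2 && !el H 3) || (el N 3 && !el H 2))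
/-- special states -/
def spec4 (P N H : List (Fin 4)) : Bool := spec4h P N H || spec4h N P H
/-- edges -/
abbrev E4_c4 : List (List (Fin 4)) := [[0, 2], [0, 3], [1, 2], [1, 3]]
/-- flags -/
abbrev c4fls : List (Flag 4) := [cA, cB,
  ![(true, 2), (false, 0), (true, 3), (false, 1)],
  ![(true, 3), (true, 1), (false, 0), (false, 2)],
  ![(true, 0), (false, 2), (false, 3), (true, 1)],
  ![(true, 1), (false, 2), (false, 0), (true, 2)],
  ![(true, 0), (true, 2), (true, 1), (true, 3)]]

theorem c4_half {K : Set (Fin 4 → ℝ)} (hK : Nrm K) (hG : ∀ T ∈ prs4, ind T ∈ K ↔ T ∈ E4_c4)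
    (hnd : ¬ ∀ z ∈ K, |z 0| + |z 1| ≤ 1) {κ η : ℝ} (hη : 0 < η) (hηκ : η < κ)
    {x : Fin 4 → ℝ} (hx : x ∈ K) (s : ℝ) (hs : s = 1 ∨ s = -1)
    (h : (0 < s * x 0 ∧ x 1 = 0 ∨ 0 < s * x 1 ∧ x 0 = 0) ∧
      (0 < s * x 2 ∧ |x 3| ≤ 1 - κ ∨ s * x 3 < 0 ∧ |x 2| ≤ 1 - κ)) :
    Illuminates K (-(s • dir η cA)) x ∨ Illuminates K (-(s • dir η cB)) x := by
  have h02 : ind [0, 2] ∈ K := (hG _ (by decide)).2 (by decide)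
  have h03 : ind [0, 3] ∈ K := (hG _ (by decide)).2 (by decide)
  have h12 : ind [1, 2] ∈ K := (hG _ (by decide)).2 (by decide)
  have h13 : ind [1, 3] ∈ K := (hG _ (by decide)).2 (by decide)
  have hnd2 : ¬ ∀ z ∈ K, |z 1| + |z 0| ≤ 1 := fun h => hnd fun z hz => by linarith [h z hz]
  have hs1 : |s| = 1 := by rcases hs with rfl | rfl <;> simp
  have ab : ∀ (f : Flag 4) i, |(s • dir η f) i| = η ^ (f i).2 := by
    intro f i
    rw [Pi.smul_apply, smul_eq_mul, abs_mul, hs1, one_mul, abs_dir f hη]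
  obtain ⟨h1, h2⟩ := h
  rcases h2 with ⟨h2, h3⟩ | ⟨h2, h3⟩
  · left
    rcases h1 with ⟨h1, h0⟩ | ⟨h1, h0⟩
    · refine c4_core hK 0 1 2 3 (by decide) (fun f => by rw [Fin.sum_univ_four]) h13 h12 hnd hηκ hx h0 h3 _
        ?_ ?_ ?_ ?_ ?_ ?_
      · simpa [dir] using h1
      · simpa [dir] using h2
      all_goals rw [ab]; simp
    · refine c4_core hK 1 0 2 3 (by decide) (fun f => by rw [Fin.sum_univ_four]; ring) h03 h02 hnd2 hηκ hx h0 h3 _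
        ?_ ?_ ?_ ?_ ?_ ?_
      · simpa [dir] using h1
      · simpa [dir] using h2
      all_goals rw [ab]; simp
  · right
    rcases h1 with ⟨h1, h0⟩ | ⟨h1, h0⟩
    · refine c4_core hK 0 1 3 2 (by decide) (fun f => by rw [Fin.sum_univ_four]; ring) h12 h13 hnd hηκ hx h0 h3 _
        ?_ ?_ ?_ ?_ ?_ ?_
      · simpa [dir] using h1
      · simpa [dir] using h2
      all_goals rw [ab]; simp
    · refine c4_core hK 1 0 3 2 (by decide) (fun f => by rw [Fin.sum_univ_four]; ring) h02 h03 hnd2 hηκ hx h0 h3 _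
        ?_ ?_ ?_ ?_ ?_ ?_
      · simpa [dir] using h1
      · simpa [dir] using h2
      all_goals rw [ab]; simp

theorem g4_c4' {K : Set (Fin 4 → ℝ)} (hK : Nrm K) (h3 : NoTriple K)
    (hG : ∀ T ∈ prs4, ind T ∈ K ↔ T ∈ E4_c4) (hnd : ¬ ∀ z ∈ K, |z 0| + |z 1| ≤ 1) : Good K := by
  have hfs := hfs4 hK h3 E4_c4 (by decide) hG
  obtain ⟨κ, hk0, hk1, hk2, hk3⟩ := machine hK [0, 1, 2, 3] ix4 ([[], [0], [1], [2], [3]] ++ E4_c4) []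
    (fun T hT => (hfs T (by revert T; decide)).2 hT) (fun T hT h => (hfs T hT).1 h) (by simp)
  obtain ⟨η, hη, hη0, hηκ⟩ := (hk3.and (ev_small κ hk0)).exists
  refine good_of_flags (by norm_num) hK c4fls (by simp) hη0 fun x hx => ?_
  have hch : check [0, 1, 2, 3] ([[], [0], [1], [2], [3]] ++ E4_c4) [] (c4fls ++ c4fls.map negf) spec4 = true := by
    decide +kernel
  rcases check_use ix4 hch hk1 x (hk2 x hx) with ⟨f, hf, hi⟩ | h
  · exact ⟨f, hf, hη x hx f hi⟩
  · simp only [spec4, spec4h, Bool.or_eq_true, Bool.and_eq_true, Bool.not_eq_true', ← Bool.not_eq_true, el_iff,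
      mem_psn ix4, mem_ngn ix4, mem_hi ix4, not_lt] at h
    have key := c4_half hK hG hnd hη0 hηκ hx
    rcases h with h | h
    · have := key 1 (Or.inl rfl) (by
        simp only [one_mul]
        refine ⟨h.1.imp (fun a => ⟨a.1, le_antisymm a.2.1 a.2.2⟩) (fun a => ⟨a.1, le_antisymm a.2.1 a.2.2⟩), ?_⟩
        exact h.2.imp (fun a => ⟨a.1, by linarith [a.2]⟩) (fun a => ⟨a.1, by linarith [a.2]⟩))
      rw [one_smul, one_smul] at this
      rcases this with h | h
      · exact ⟨cA, by simp, h⟩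
      · exact ⟨cB, by simp, h⟩
    · have := key (-1) (Or.inr rfl) (by
        simp only [neg_mul, one_mul]
        refine ⟨h.1.imp (fun a => ⟨by linarith [a.1], le_antisymm a.2.2 a.2.1⟩)
          (fun a => ⟨by linarith [a.1], le_antisymm a.2.2 a.2.1⟩), ?_⟩
        exact h.2.imp (fun a => ⟨by linarith [a.1], by linarith [a.2]⟩)
          (fun a => ⟨by linarith [a.1], by linarith [a.2]⟩))
      rw [neg_smul, neg_smul, one_smul, one_smul] at this
      rcases this with h | h
      · exact ⟨negf cA, by simp, by rw [dir_negf]; exact h⟩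
      · exact ⟨negf cB, by simp, by rw [dir_negf]; exact h⟩

theorem ind_swap {n : ℕ} (i j : Fin n) : ind [i, j] = ind [j, i] := by ext a; simp [ind, or_comm]

theorem noTriple_perm {K : Set (Fin 4 → ℝ)} (h : NoTriple K) (σ : Equiv.Perm (Fin 4)) : NoTriple (permL σ '' K) := by
  intro i j k hij hik hjk
  rw [ind_perm]
  exact h _ _ _ (σ.injective.ne hij) (σ.injective.ne hik) (σ.injective.ne hjk)

theorem prs4_iff {K : Set (Fin 4 → ℝ)} (E : List (List (Fin 4))) :
    (∀ T ∈ prs4, ind T ∈ K ↔ T ∈ E) ↔ ((ind [0, 1] ∈ K ↔ [0, 1] ∈ E) ∧ (ind [0, 2] ∈ K ↔ [0, 2] ∈ E) ∧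
      (ind [0, 3] ∈ K ↔ [0, 3] ∈ E) ∧ (ind [1, 2] ∈ K ↔ [1, 2] ∈ E) ∧ (ind [1, 3] ∈ K ↔ [1, 3] ∈ E) ∧
      (ind [2, 3] ∈ K ↔ [2, 3] ∈ E)) := by
  simp only [prs4, List.mem_cons, List.not_mem_nil, or_false, forall_eq_or_imp, forall_eq]

theorem g4_c4 {K : Set (Fin 4 → ℝ)} (hK : Nrm K) (h3 : NoTriple K)
    (hG : ∀ T ∈ prs4, ind T ∈ K ↔ T ∈ E4_c4) (hpar : ¬ IsParallelepiped K) : Good K := by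
  by_cases hnd : ∀ z ∈ K, |z 0| + |z 1| ≤ 1
  · have h02 : ind [0, 2] ∈ K := (hG _ (by decide)).2 (by decide)
    have h03 : ind [0, 3] ∈ K := (hG _ (by decide)).2 (by decide)
    have h12 : ind [1, 2] ∈ K := (hG _ (by decide)).2 (by decide)
    have h13 : ind [1, 3] ∈ K := (hG _ (by decide)).2 (by decide)
    have hnd2 : ¬ ∀ z ∈ K, |z 2| + |z 3| ≤ 1 := fun h => hpar (par_c4 hK h02 h03 h12 h13 hnd h)
    set σ : Equiv.Perm (Fin 4) := Equiv.swap 0 2 * Equiv.swap 1 3 with hσ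
    have s0 : σ 0 = 2 := by rw [hσ]; decide
    have s1 : σ 1 = 3 := by rw [hσ]; decide
    have s2 : σ 2 = 0 := by rw [hσ]; decide
    have s3 : σ 3 = 1 := by rw [hσ]; decide
    refine good_image (permL σ) (g4_c4' (nrm_perm hK σ) (noTriple_perm h3 σ) ?_ ?_)
    · rw [prs4_iff] at hG ⊢
      simp only [ind_perm, List.map_cons, List.map_nil, s0, s1, s2, s3]
      rw [ind_swap 2 0, ind_swap 3 0, ind_swap 2 1, ind_swap 3 1]
      obtain ⟨a, b, c, d, e, f⟩ := hG
      rw [a, b, c, d, e, f]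
      refine ⟨?_, ?_, ?_, ?_, ?_, ?_⟩ <;> decide
    · intro h
      apply hnd2
      intro z hz
      have := h _ ⟨z, hz, rfl⟩
      simpa only [permL_apply, s0, s1] using this
  · exact g4_c4' hK h3 hG hnd

end Ill

namespace Ill
open Filter Topology

/-- `i, j, k` are the coordinates `0, 1, 2` in some order -/
structure Tri (i j k : Fin 4) : Prop where
  ij : i ≠ j
  ik : i ≠ k
  jk : j ≠ k
  i3 : i ≠ 3
  j3 : j ≠ 3
  k3 : k ≠ 3

theorem tri_aux : ∀ i j k : Fin 4, i ≠ j → i ≠ k → j ≠ k → i ≠ 3 → j ≠ 3 → k ≠ 3 →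
    (Finset.univ : Finset (Fin 4)) = {i, j, k, 3} := by decide

theorem tri_aux2 : ∀ i j k l : Fin 4, i ≠ j → i ≠ k → j ≠ k → i ≠ 3 → j ≠ 3 → k ≠ 3 →
    (l ∈ [i, j, k] ↔ l ∈ [0, 1, 2]) := by decide

theorem Tri.sum {i j k : Fin 4} (h : Tri i j k) (f : Fin 4 → ℝ) : ∑ l, f l = f i + f j + f k + f 3 := by
  rw [tri_aux i j k h.ij h.ik h.jk h.i3 h.j3 h.k3, Finset.sum_insert, Finset.sum_insert, Finset.sum_insert,
    Finset.sum_singleton]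
  · ring
  · simpa using h.k3
  · simpa using ⟨h.jk, h.j3⟩
  · simpa using ⟨h.ij, h.ik, h.i3⟩

theorem Tri.ind {i j k : Fin 4} (h : Tri i j k) : ind [i, j, k] = ind [0, 1, 2] := by
  ext l
  unfold Ill.ind
  simp only [tri_aux2 i j k l h.ij h.ik h.jk h.i3 h.j3 h.k3]

theorem Tri.f1 {i j k : Fin 4} (h : Tri i j k) {K : Set (Fin 4 → ℝ)} (hK3 : Ill.ind [0, 1, 2] ∈ K) {x μ : Fin 4 → ℝ}
    (hA : Adm K x μ) : (1 - |x i|) * μ i + (1 - |x j|) * μ j + (1 - |x k|) * μ k ≤ |x 3| * μ 3 := by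
  rw [← h.ind] at hK3
  have := hA.le _ hK3
  rw [h.sum, h.sum] at this
  simp [Ill.ind, h.i3.symm, h.j3.symm, h.k3.symm] at this
  linarith

theorem Tri.f2 {i j k : Fin 4} (h : Tri i j k) {K : Set (Fin 4 → ℝ)} (hK : Nrm K) {x μ : Fin 4 → ℝ}
    (hA : Adm K x μ) : (1 - |x 3|) * μ 3 ≤ |x i| * μ i + |x j| * μ j + |x k| * μ k := by
  have := hA.le _ (hK.basis 3)
  rw [h.sum, h.sum] at this
  simp [h.i3, h.j3, h.k3] at this
  linarith

theorem Tri.pos {i j k : Fin 4} (h : Tri i j k) {K : Set (Fin 4 → ℝ)} {x μ : Fin 4 → ℝ}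
    (hA : Adm K x μ) : 0 < μ i + μ j + μ k + μ 3 := by
  by_contra hc
  push Not at hc
  exact adm_sum_zero hA (by rw [h.sum]; exact hc)

theorem all_right {n : ℕ} {K : Set (Fin n → ℝ)} (hK : Nrm K) {x : Fin n → ℝ} (hx : x ∈ K) (v : Fin n → ℝ)
    (h : ∀ l, 0 < v l * x l) : Illuminates K (-v) x := by
  refine illum_of_adm hK hx _ fun μ hA => ?_
  have h1 : ∀ l, gc (v l) (x l) (μ l) = |v l| * μ l := fun l => gc_right (h l)
  have h2 : ∀ l, 0 < |v l| := fun l => by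
    rw [abs_pos]; intro h0; have := h l; rw [h0, zero_mul] at this; exact lt_irrefl _ this
  simp only [h1]
  obtain ⟨l, hl⟩ : ∃ l, μ l ≠ 0 := by
    by_contra hc; push Not at hc
    exact hA.ne (funext hc)
  refine Finset.sum_pos' (fun l _ => mul_nonneg (h2 l).le (hA.nn l)) ⟨l, Finset.mem_univ _, mul_pos (h2 l) ?_⟩
  exact lt_of_le_of_ne (hA.nn l) (Ne.symm hl)

theorem lemM_aux {κ a c x m : ℝ} (hκ : 0 < κ) (hm : 0 ≤ m) (ha : a ≤ 1) (hc : |c| = 1) (h : 0 < c * x ∨ a ≤ 1 - κ) :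
    m ≤ gc c x m + 2 / κ * ((1 - a) * m) := by
  rcases h with h | h
  · rw [gc_right h, hc]
    have : 0 ≤ 2 / κ * ((1 - a) * m) := by
      have : 0 ≤ 1 - a := by linarith
      positivity
    linarith
  · have h1 := gc_ge (c := c) (x := x) hm
    rw [hc] at h1
    have h2 : 2 / κ * (κ * m) ≤ 2 / κ * ((1 - a) * m) := by
      have : κ ≤ 1 - a := by linarith
      gcongr
    have h3 : 2 / κ * (κ * m) = 2 * m := by field_simp
    linarith

theorem lemM {K : Set (Fin 4 → ℝ)} (hK : Nrm K) (hK3 : ind [0, 1, 2] ∈ K) {i j k : Fin 4} (hT : Tri i j k)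
    {κ : ℝ} (hκ : 0 < κ) {x : Fin 4 → ℝ} (hx : x ∈ K) (v : Fin 4 → ℝ)
    (vi : |v i| = 1) (vj : |v j| = 1) (vk : |v k| = 1) (v3 : |v 3| = 3 / κ)
    (h3 : 0 < v 3 * x 3) (hi : 0 < v i * x i ∨ |x i| ≤ 1 - κ) (hj : 0 < v j * x j ∨ |x j| ≤ 1 - κ)
    (hk : 0 < v k * x k ∨ |x k| ≤ 1 - κ) : Illuminates K (-v) x := by
  refine illum_of_adm hK hx _ fun μ hA => ?_
  have f1 := hT.f1 hK3 hA
  have fp := hT.pos hA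
  rw [hT.sum, gc_right h3, v3]
  have gi := lemM_aux hκ (hA.nn i) (hK.le1 x hx i) vi hi
  have gj := lemM_aux hκ (hA.nn j) (hK.le1 x hx j) vj hj
  have gk := lemM_aux hκ (hA.nn k) (hK.le1 x hx k) vk hk
  have a3 := hK.le1 x hx 3
  have n3 := hA.nn 3
  have f3 : 2 / κ * ((1 - |x i|) * μ i + (1 - |x j|) * μ j + (1 - |x k|) * μ k) ≤ 2 / κ * μ 3 := by
    have : |x 3| * μ 3 ≤ μ 3 := by nlinarith
    have := f1.trans this
    gcongr
  have f4 : 3 / κ * μ 3 = 2 / κ * μ 3 + 1 / κ * μ 3 := by ring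
  rw [f4]
  rcases n3.lt_or_eq with h | h
  · have : 0 < 1 / κ * μ 3 := by positivity
    linarith [hA.nn i, hA.nn j, hA.nn k]
  · rw [← h] at f3 fp ⊢
    simp only [mul_zero, add_zero] at f3 fp ⊢
    linarith

theorem lemW1 {K : Set (Fin 4 → ℝ)} (hK : Nrm K) {κ δ : ℝ} (hδ : 0 < δ) (hδκ : δ < κ)
    {x : Fin 4 → ℝ} (hx : x ∈ K) (v : Fin 4 → ℝ)
    (v0 : |v 0| = 1) (v1 : |v 1| = 1) (v2 : |v 2| = 1) (v3 : |v 3| = δ) (h3 : |x 3| ≤ 1 - κ)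
    (h0 : 0 < v 0 * x 0) (h1 : 0 < v 1 * x 1) (h2 : 0 < v 2 * x 2) : Illuminates K (-v) x := by
  have hT : Tri 0 1 2 := by constructor <;> decide
  refine illum_of_adm hK hx _ fun μ hA => ?_
  have f2 := hT.f2 hK hA
  have fp := hT.pos hA
  rw [hT.sum, gc_right h0, gc_right h1, gc_right h2, v0, v1, v2]
  have g3 := gc_ge (c := v 3) (x := x 3) (hA.nn 3)
  rw [v3] at g3
  have n0 := hA.nn 0
  have n1 := hA.nn 1
  have n2 := hA.nn 2
  have n3 := hA.nn 3
  have q0 : |x 0| * μ 0 ≤ μ 0 := by nlinarith [hK.le1 x hx 0]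
  have q1 : |x 1| * μ 1 ≤ μ 1 := by nlinarith [hK.le1 x hx 1]
  have q2 : |x 2| * μ 2 ≤ μ 2 := by nlinarith [hK.le1 x hx 2]
  have q3 : κ * μ 3 ≤ (1 - |x 3|) * μ 3 := by
    have : κ ≤ 1 - |x 3| := by linarith
    gcongr
  rcases n3.lt_or_eq with h | h
  · have : 0 < (κ - δ) * μ 3 := mul_pos (by linarith) h
    linarith
  · rw [← h] at g3 fp ⊢
    linarith

theorem low_zero {a m : ℝ} (ha : a < 1) (h : (1 - a) * m ≤ 0) (hm : 0 ≤ m) : m = 0 := by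
  refine le_antisymm ?_ hm
  by_contra hc; push Not at hc
  have := mul_pos (sub_pos.2 ha) hc
  linarith

theorem zero_gc {a c x m : ℝ} (hc : |c| = 1) (h : 0 < c * x ∨ a < 1) (h1 : (1 - a) * m ≤ 0) (hm : 0 ≤ m) :
    gc c x m = m := by
  rcases h with h | h
  · rw [gc_right h, hc, one_mul]
  · rw [low_zero h h1 hm]; simp [gc]

theorem zero3 {K : Set (Fin 4 → ℝ)} (hK : Nrm K) (hK3 : ind [0, 1, 2] ∈ K) {i j k : Fin 4} (hT : Tri i j k)
    {x μ : Fin 4 → ℝ} (hx : x ∈ K) (hA : Adm K x μ) (h3 : x 3 = 0) :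
    (1 - |x i|) * μ i ≤ 0 ∧ (1 - |x j|) * μ j ≤ 0 ∧ (1 - |x k|) * μ k ≤ 0 ∧ μ 3 ≤ μ i + μ j + μ k := by
  have f1 := hT.f1 hK3 hA
  have f2 := hT.f2 hK hA
  rw [h3, abs_zero] at f1 f2
  have qi : 0 ≤ (1 - |x i|) * μ i := mul_nonneg (by linarith [hK.le1 x hx i]) (hA.nn i)
  have qj : 0 ≤ (1 - |x j|) * μ j := mul_nonneg (by linarith [hK.le1 x hx j]) (hA.nn j)
  have qk : 0 ≤ (1 - |x k|) * μ k := mul_nonneg (by linarith [hK.le1 x hx k]) (hA.nn k)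
  refine ⟨?_, ?_, ?_, ?_⟩ <;> linarith

theorem lemW0 {K : Set (Fin 4 → ℝ)} (hK : Nrm K) (hK3 : ind [0, 1, 2] ∈ K) {δ : ℝ} (hδ1 : δ < 1)
    {x : Fin 4 → ℝ} (hx : x ∈ K) (v : Fin 4 → ℝ)
    (v0 : |v 0| = 1) (v1 : |v 1| = 1) (v2 : |v 2| = 1) (v3 : |v 3| = δ) (h3 : x 3 = 0)
    (h0 : 0 < v 0 * x 0 ∨ |x 0| < 1) (h1 : 0 < v 1 * x 1 ∨ |x 1| < 1) (h2 : 0 < v 2 * x 2 ∨ |x 2| < 1) :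
    Illuminates K (-v) x := by
  have hT : Tri 0 1 2 := by constructor <;> decide
  refine illum_of_adm hK hx _ fun μ hA => ?_
  obtain ⟨z0, z1, z2, z3⟩ := zero3 hK hK3 hT hx hA h3
  have fp := hT.pos hA
  rw [hT.sum, zero_gc v0 h0 z0 (hA.nn 0), zero_gc v1 h1 z1 (hA.nn 1), zero_gc v2 h2 z2 (hA.nn 2)]
  have g3 := gc_ge (c := v 3) (x := x 3) (hA.nn 3)
  rw [v3] at g3
  have n3 := hA.nn 3
  rcases n3.lt_or_eq with h | h
  · have : 0 < (1 - δ) * μ 3 := mul_pos (by linarith) h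
    linarith
  · rw [← h] at g3 fp ⊢
    linarith

theorem diamond_of {K : Set (Fin 4 → ℝ)} {i j k : Fin 4} (hT : Tri i j k) {x μ : Fin 4 → ℝ} (hA : Adm K x μ)
    (hj : μ j = 0) (hk : μ k = 0) (h3 : μ 3 = μ i) (hx : |x i| + |x 3| ≤ 1) : ∀ z ∈ K, |z i| + |z 3| ≤ 1 := by
  intro z hz
  have fp := hT.pos hA
  have := hA.le z hz
  rw [hT.sum, hT.sum, hj, hk, h3] at this
  have hm : 0 < μ i := by linarith
  have h9 : μ i * (|z i| + |z 3|) ≤ μ i * 1 := by nlinarith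
  exact le_of_mul_le_mul_left h9 hm

/-- choice of the second small parameter -/
def DP (K : Set (Fin 4 → ℝ)) (κ δ : ℝ) (i j k : Fin 4) (δ' : ℝ) : Prop :=
  (δ' = δ ∧ ¬ ∀ z ∈ K, |z i| + |z 3| ≤ 1) ∨
    (δ' = δ * (1 + κ) ∧ ∀ x ∈ K, ¬ (1 - κ < |x j| ∧ 1 - κ < |x k| ∧ 1 - κ < |x 3|))

theorem lemD0 {K : Set (Fin 4 → ℝ)} (hK : Nrm K) (hK3 : ind [0, 1, 2] ∈ K) {i j k : Fin 4} (hT : Tri i j k)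
    {κ δ δ' : ℝ} (hκ : 0 < κ) (hδ : 0 < δ) (hδ1 : δ < 1) (hd : DP K κ δ i j k δ')
    {x : Fin 4 → ℝ} (hx : x ∈ K) (v : Fin 4 → ℝ)
    (vi : |v i| = δ') (vj : |v j| = 1) (vk : |v k| = 1) (v3 : |v 3| = δ) (h3 : x 3 = 0)
    (hi : 0 < v i * x i) (hj : 0 < v j * x j ∨ |x j| < 1) (hk : 0 < v k * x k ∨ |x k| < 1) :
    Illuminates K (-v) x := by
  refine illum_of_adm hK hx _ fun μ hA => ?_
  obtain ⟨zi, zj, zk, z3⟩ := zero3 hK hK3 hT hx hA h3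
  have fp := hT.pos hA
  rw [hT.sum, gc_right hi, vi, zero_gc vj hj zj (hA.nn j), zero_gc vk hk zk (hA.nn k)]
  have g3 := gc_ge (c := v 3) (x := x 3) (hA.nn 3)
  rw [v3] at g3
  have ni := hA.nn i
  have nj := hA.nn j
  have nk := hA.nn k
  have n3 := hA.nn 3
  have m3 : δ * μ 3 ≤ δ * (μ i + μ j + μ k) := by gcongr
  rcases hd with ⟨rfl, hnd⟩ | ⟨rfl, -⟩
  · by_contra hcon
    push Not at hcon
    have q1 : (1 - δ') * (μ j + μ k) ≤ 0 := by linarith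
    have q2 : μ j + μ k = 0 := by
      refine low_zero hδ1 q1 (by linarith)
    have qj : μ j = 0 := by linarith
    have qk : μ k = 0 := by linarith
    rw [qj, qk] at hcon z3
    have q3 : δ' * μ i ≤ δ' * μ 3 := by linarith
    have q4 := le_of_mul_le_mul_left q3 hδ
    refine hnd (diamond_of hT hA qj qk (by linarith) ?_)
    rw [h3, abs_zero, add_zero]; exact hK.le1 x hx i
  · have e1 : 0 ≤ (1 - δ) * (μ j + μ k) := mul_nonneg (by linarith) (by linarith)
    have e2 : 0 ≤ δ * κ * μ i := by positivity
    rcases ni.lt_or_eq with h | h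
    · have : 0 < δ * κ * μ i := by positivity
      linarith
    · have : 0 < μ j + μ k := by linarith
      have : 0 < (1 - δ) * (μ j + μ k) := mul_pos (by linarith) this
      linarith

theorem lemD1 {K : Set (Fin 4 → ℝ)} (hK : Nrm K) (hK3 : ind [0, 1, 2] ∈ K) {i j k : Fin 4} (hT : Tri i j k)
    {κ δ δ' : ℝ} (hκ : 0 < κ) (hκ1 : κ < 1) (hδ : 0 < δ) (hd : DP K κ δ i j k δ')
    {x : Fin 4 → ℝ} (hx : x ∈ K) (v : Fin 4 → ℝ)
    (vi : |v i| = δ') (vj : |v j| = 1) (vk : |v k| = 1) (v3 : |v 3| = δ) (h3 : 0 < v 3 * x 3)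
    (hi : x i = 0) (hj : 0 < v j * x j) (hk : 0 < v k * x k) (hj1 : 1 - κ < |x j|) (hk1 : 1 - κ < |x k|) :
    Illuminates K (-v) x := by
  refine illum_of_adm hK hx _ fun μ hA => ?_
  have f1 := hT.f1 hK3 hA
  have fp := hT.pos hA
  rw [hi, abs_zero] at f1
  rw [hT.sum, gc_right h3, gc_right hj, gc_right hk, vj, vk, v3]
  have gi := gc_ge (c := v i) (x := x i) (hA.nn i)
  rw [vi] at gi
  have ni := hA.nn i
  have nj := hA.nn j
  have nk := hA.nn k
  have n3 := hA.nn 3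
  have qj : 0 ≤ (1 - |x j|) * μ j := mul_nonneg (by linarith [hK.le1 x hx j]) (hA.nn j)
  have qk : 0 ≤ (1 - |x k|) * μ k := mul_nonneg (by linarith [hK.le1 x hx k]) (hA.nn k)
  have m1 : μ i ≤ |x 3| * μ 3 := by linarith
  have a3 := hK.le1 x hx 3
  have m2 : |x 3| * μ 3 ≤ μ 3 := by nlinarith
  rcases hd with ⟨rfl, hnd⟩ | ⟨rfl, hf⟩
  · by_contra hcon
    push Not at hcon
    have q0 : δ' * μ i ≤ δ' * μ 3 := by gcongr; linarith
    have ej : μ j = 0 := by linarith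
    have ek : μ k = 0 := by linarith
    have q3 : δ' * μ 3 ≤ δ' * μ i := by linarith
    have q4 := le_of_mul_le_mul_left q3 hδ
    refine hnd (diamond_of hT hA ej ek (by linarith) ?_)
    rw [hi, abs_zero, zero_add]; exact a3
  · have l3 : |x 3| ≤ 1 - κ := by
      by_contra hc; push Not at hc
      exact hf x hx ⟨hj1, hk1, hc⟩
    have m4 : |x 3| * μ 3 ≤ (1 - κ) * μ 3 := by gcongr
    have m5 : δ * (1 + κ) * μ i ≤ δ * (1 + κ) * ((1 - κ) * μ 3) := by gcongr; linarith
    rcases n3.lt_or_eq with h | h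
    · have : 0 < δ * κ ^ 2 * μ 3 := by positivity
      linarith
    · rw [← h] at m1 m2 m5 fp ⊢
      linarith

/-- the direction `w` -/
def vw (δ : ℝ) : Fin 4 → ℝ := fun l => if l = 3 then -δ else 1
/-- the directions with a large last coordinate -/
def vM (M : ℝ) (i : Fin 4) : Fin 4 → ℝ := fun l => if l = 3 then M else if l = i then -1 else 1
/-- the directions with two small coordinates -/
def vd (δ δ' : ℝ) (i : Fin 4) : Fin 4 → ℝ := fun l => if l = 3 then -δ else if l = i then -δ' else 1

theorem illum_neg {n : ℕ} {K : Set (Fin n → ℝ)} (hK : Nrm K) {d x : Fin n → ℝ} (h : Illuminates K (-d) (-x)) :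
    Illuminates K d x := by
  obtain ⟨ε, h0, h1⟩ := h
  refine ⟨ε, h0, ?_⟩
  have hKn : -K = K := by
    have : ∀ x ∈ K, -x ∈ K := fun x hx => down hK.conv hK.unc hx (fun i => by simp)
    ext y
    exact ⟨fun h => by simpa using this _ h, fun h => this _ h⟩
  have h2 : -(x + ε • d) ∈ interior K := by
    convert h1 using 1
    rw [smul_neg, neg_add]
  have h3 : interior K = -interior K := by
    conv_lhs => rw [← hKn]
    exact ((Homeomorph.neg (Fin n → ℝ)).preimage_interior K).symm
  rw [h3]
  exact h2

/-- lit by one of the directions or its negative -/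
def Lit (K : Set (Fin 4 → ℝ)) (vs : List (Fin 4 → ℝ)) (x : Fin 4 → ℝ) : Prop :=
  ∃ v ∈ vs, Illuminates K (-v) x ∨ Illuminates K v x

theorem lit_neg {K : Set (Fin 4 → ℝ)} (hK : Nrm K) {vs : List (Fin 4 → ℝ)} {x : Fin 4 → ℝ} (h : Lit K vs (-x)) :
    Lit K vs x := by
  obtain ⟨v, hv, h | h⟩ := h
  · exact ⟨v, hv, Or.inr (illum_neg hK h)⟩
  · exact ⟨v, hv, Or.inl (illum_neg hK (by rwa [neg_neg]))⟩

theorem good_of_lit {K : Set (Fin 4 → ℝ)} (hK : Nrm K) (vs : List (Fin 4 → ℝ)) (hlen : vs.length ≤ 7)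
    (h0 : ∀ v ∈ vs, v ≠ 0) (h : ∀ x ∈ K, Lit K vs x) : Good K := by
  classical
  refine ⟨(vs ++ vs.map (fun v => -v)).toFinset, ?_, ?_, ?_, ?_⟩
  · intro d hd
    simp only [List.mem_toFinset, List.mem_map, List.mem_append] at hd
    rcases hd with hd | ⟨v, hv, rfl⟩
    · exact h0 d hd
    · exact neg_ne_zero.2 (h0 v hv)
  · intro d hd
    simp only [List.mem_toFinset, List.mem_map, List.mem_append] at hd ⊢
    rcases hd with hd | ⟨v, hv, rfl⟩
    · exact Or.inr ⟨d, hd, rfl⟩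
    · rw [neg_neg]; exact Or.inl hv
  · refine (List.toFinset_card_le _).trans ?_
    simp only [List.length_map, List.length_append]
    omega
  · intro x hx
    obtain ⟨v, hv, h | h⟩ := h x (hK.cpt.isClosed.frontier_subset hx)
    · refine ⟨-v, ?_, h⟩
      simp only [List.coe_toFinset, Set.mem_ofPred_eq, List.mem_map, List.mem_append]
      exact Or.inr ⟨v, hv, rfl⟩
    · refine ⟨v, ?_, h⟩
      simp only [List.coe_toFinset, Set.mem_ofPred_eq, List.mem_map, List.mem_append]
      exact Or.inl hv

end Ill

namespace Ill
open Filter Topology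

/-- parameters of the construction -/
structure Par (K : Set (Fin 4 → ℝ)) (κ δ : ℝ) (dp : Fin 4 → ℝ) (vs : List (Fin 4 → ℝ)) : Prop where
  hK : Nrm K
  hK3 : ind [0, 1, 2] ∈ K
  κ0 : 0 < κ
  κ1 : κ < 1
  δ0 : 0 < δ
  δκ : δ < κ
  face : ∀ x ∈ K, ¬ (1 - κ < |x 0| ∧ 1 - κ < |x 1| ∧ 1 - κ < |x 2| ∧ 1 - κ < |x 3|)
  hdp : ∀ i j k, Tri i j k → DP K κ δ i j k (dp i)
  mw : vw δ ∈ vs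
  mM : ∀ i, i ≠ 3 → vM (3 / κ) i ∈ vs
  md : ∀ i, i ≠ 3 → vd δ (dp i) i ∈ vs

theorem Tri.swap {i j k : Fin 4} (h : Tri i j k) : Tri i k j := ⟨h.ik, h.ij, h.jk.symm, h.i3, h.k3, h.j3⟩
theorem Tri.rot {i j k : Fin 4} (h : Tri i j k) : Tri j k i := ⟨h.jk, h.ij.symm, h.ik.symm, h.j3, h.k3, h.i3⟩
theorem tri012 : Tri 0 1 2 := by constructor <;> decide

section
variable {K : Set (Fin 4 → ℝ)} {κ δ : ℝ} {dp : Fin 4 → ℝ} {vs : List (Fin 4 → ℝ)}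

theorem Par.dpos (P : Par K κ δ dp vs) {i j k : Fin 4} (h : Tri i j k) : 0 < dp i := by
  have := P.κ0
  have := P.δ0
  rcases P.hdp i j k h with ⟨h, -⟩ | ⟨h, -⟩ <;> rw [h] <;> positivity

theorem Par.useM (P : Par K κ δ dp vs) {i j k : Fin 4} (hT : Tri i j k) {x : Fin 4 → ℝ} (hx : x ∈ K) (h3 : 0 < x 3)
    (hi : x i < 0 ∨ |x i| ≤ 1 - κ) (hj : 0 < x j ∨ |x j| ≤ 1 - κ) (hk : 0 < x k ∨ |x k| ≤ 1 - κ) : Lit K vs x := by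
  have := P.κ0
  have ei : vM (3 / κ) i i = -1 := by simp [vM, hT.i3]
  have ej : vM (3 / κ) i j = 1 := by simp [vM, hT.j3, hT.ij.symm]
  have ek : vM (3 / κ) i k = 1 := by simp [vM, hT.k3, hT.ik.symm]
  have e3 : vM (3 / κ) i 3 = 3 / κ := by simp [vM]
  refine ⟨_, P.mM i hT.i3, Or.inl (lemM P.hK P.hK3 hT P.κ0 hx _ ?_ ?_ ?_ ?_ ?_ ?_ ?_ ?_)⟩
  · rw [ei]; simp
  · rw [ej]; simp
  · rw [ek]; simp
  · rw [e3, abs_of_pos]; positivity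
  · rw [e3]; positivity
  · rw [ei]; exact hi.imp_left (fun h => by linarith)
  · rw [ej]; exact hj.imp_left (fun h => by linarith)
  · rw [ek]; exact hk.imp_left (fun h => by linarith)

theorem Par.pos (P : Par K κ δ dp vs) {x : Fin 4 → ℝ} (hx : x ∈ K) (h3 : 0 < x 3) : Lit K vs x := by
  have k0 := P.κ0
  have k1 := P.κ1
  have d0 := P.δ0
  have lowz : ∀ l, x l = 0 → |x l| ≤ 1 - κ := fun l h => by rw [h, abs_zero]; linarith
  have nn : ∀ l, 0 ≤ x l → 0 < x l ∨ |x l| ≤ 1 - κ := fun l h => h.lt_or_eq.imp_right (fun h => lowz l h.symm)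
  have np : ∀ l, x l ≤ 0 → x l < 0 ∨ |x l| ≤ 1 - κ := fun l h => h.lt_or_eq.imp_right (fun h => lowz l h)
  have caseB : ∀ i j k, Tri i j k → x i ≤ 0 → 0 ≤ x j → 0 ≤ x k → Lit K vs x := fun i j k hT a b c =>
    P.useM hT hx h3 (np i a) (nn j b) (nn k c)
  have caseC : ∀ i j k, Tri i j k → 0 ≤ x i → x j < 0 → x k < 0 → Lit K vs x := by
    intro i j k hT a b c
    have ei : (-vd δ (dp i) i) i = dp i := by simp [vd, hT.i3]
    have ej : (-vd δ (dp i) i) j = -1 := by simp [vd, hT.j3, hT.ij.symm]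
    have ek : (-vd δ (dp i) i) k = -1 := by simp [vd, hT.k3, hT.ik.symm]
    have e3 : (-vd δ (dp i) i) 3 = δ := by simp [vd]
    have dpos := P.dpos hT
    rcases a.lt_or_eq with a | a
    · refine ⟨_, P.md i hT.i3, Or.inr ?_⟩
      rw [← neg_neg (vd δ (dp i) i)]
      refine all_right P.hK hx _ fun l => ?_
      rcases fin4_cases i j k l hT.ij hT.ik hT.jk hT.i3 hT.j3 hT.k3 with h | h | h | h <;> rw [h]
      · rw [ei]; positivity
      · rw [ej]; linarith
      · rw [ek]; linarith
      · rw [e3]; positivity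
    · by_cases hj : |x j| ≤ 1 - κ
      · exact P.useM hT.rot.rot hx h3 (Or.inl c) (Or.inr (lowz i a.symm)) (Or.inr hj)
      · by_cases hk : |x k| ≤ 1 - κ
        · exact P.useM hT.rot hx h3 (Or.inl b) (Or.inr hk) (Or.inr (lowz i a.symm))
        · push Not at hj hk
          refine ⟨_, P.md i hT.i3, Or.inr ?_⟩
          rw [← neg_neg (vd δ (dp i) i)]
          refine lemD1 P.hK P.hK3 hT P.κ0 P.κ1 P.δ0 (P.hdp i j k hT) hx _ ?_ ?_ ?_ ?_ ?_ a.symm ?_ ?_ hj hk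
          · rw [ei, abs_of_pos dpos]
          · rw [ej]; simp
          · rw [ek]; simp
          · rw [e3, abs_of_pos d0]
          · rw [e3]; positivity
          · rw [ej]; linarith
          · rw [ek]; linarith
  have t := tri012
  rcases le_or_gt 0 (x 0) with a0 | a0 <;> rcases le_or_gt 0 (x 1) with a1 | a1 <;>
    rcases le_or_gt 0 (x 2) with a2 | a2
  · rcases a0.lt_or_eq with b0 | b0
    swap
    · exact caseB 0 1 2 t b0.ge a1 a2
    rcases a1.lt_or_eq with b1 | b1
    swap
    · exact caseB 1 2 0 t.rot b1.ge a2 a0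
    rcases a2.lt_or_eq with b2 | b2
    swap
    · exact caseB 2 0 1 t.rot.rot b2.ge a0 a1
    by_cases l3 : |x 3| ≤ 1 - κ
    · refine ⟨_, P.mw, Or.inl (lemW1 P.hK P.δ0 P.δκ hx _ ?_ ?_ ?_ ?_ l3 ?_ ?_ ?_)⟩
      · simp [vw]
      · simp [vw]
      · simp [vw]
      · simp [vw, abs_of_pos d0]
      · simpa [vw] using b0
      · simpa [vw] using b1
      · simpa [vw] using b2
    by_cases l0 : |x 0| ≤ 1 - κ
    · exact P.useM t hx h3 (Or.inr l0) (Or.inl b1) (Or.inl b2)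
    by_cases l1 : |x 1| ≤ 1 - κ
    · exact P.useM t.rot hx h3 (Or.inr l1) (Or.inl b2) (Or.inl b0)
    by_cases l2 : |x 2| ≤ 1 - κ
    · exact P.useM t.rot.rot hx h3 (Or.inr l2) (Or.inl b0) (Or.inl b1)
    push Not at l0 l1 l2 l3
    exact absurd ⟨l0, l1, l2, l3⟩ (P.face x hx)
  · exact caseB 2 0 1 t.rot.rot a2.le a0 a1
  · exact caseB 1 2 0 t.rot a1.le a2 a0
  · exact caseC 0 1 2 t a0 a1 a2
  · exact caseB 0 1 2 t a0.le a1 a2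
  · exact caseC 1 2 0 t.rot a1 a2 a0
  · exact caseC 2 0 1 t.rot.rot a2 a0 a1
  · refine ⟨_, P.mw, Or.inr ?_⟩
    rw [← neg_neg (vw δ)]
    refine all_right P.hK hx _ fun l => ?_
    rcases fin4_cases 0 1 2 l t.ij t.ik t.jk t.i3 t.j3 t.k3 with h | h | h | h <;> rw [h]
    · simpa [vw] using a0
    · simpa [vw] using a1
    · simpa [vw] using a2
    · simpa [vw] using mul_pos d0 h3

theorem Par.zero (P : Par K κ δ dp vs) {x : Fin 4 → ℝ} (hx : x ∈ K) (h3 : x 3 = 0) : Lit K vs x := by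
  have k0 := P.κ0
  have k1 := P.κ1
  have d0 := P.δ0
  have d1 : δ < 1 := P.δκ.trans k1
  have pn : ∀ l, ¬ (0 < x l ∨ |x l| < 1) → x l < 0 := by
    intro l h
    push Not at h
    refine lt_of_le_of_ne h.1 fun h0 => ?_
    rw [h0, abs_zero] at h
    linarith [h.2]
  have np : ∀ l, ¬ (x l < 0 ∨ |x l| < 1) → 0 < x l := by
    intro l h
    push Not at h
    refine lt_of_le_of_ne h.1 fun h0 => ?_
    rw [← h0, abs_zero] at h
    linarith [h.2]
  have allP : (0 < x 0 ∨ |x 0| < 1) → (0 < x 1 ∨ |x 1| < 1) → (0 < x 2 ∨ |x 2| < 1) → Lit K vs x := by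
    intro a b c
    refine ⟨_, P.mw, Or.inl (lemW0 P.hK P.hK3 d1 hx _ ?_ ?_ ?_ ?_ h3 ?_ ?_ ?_)⟩
    · simp [vw]
    · simp [vw]
    · simp [vw]
    · simp [vw, abs_of_pos d0]
    · simpa [vw] using a
    · simpa [vw] using b
    · simpa [vw] using c
  have allN : (x 0 < 0 ∨ |x 0| < 1) → (x 1 < 0 ∨ |x 1| < 1) → (x 2 < 0 ∨ |x 2| < 1) → Lit K vs x := by
    intro a b c
    refine ⟨_, P.mw, Or.inr ?_⟩
    rw [← neg_neg (vw δ)]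
    refine lemW0 P.hK P.hK3 d1 hx _ ?_ ?_ ?_ ?_ h3 ?_ ?_ ?_
    · simp [vw]
    · simp [vw]
    · simp [vw]
    · simp [vw, abs_of_pos d0]
    · simpa [vw] using a
    · simpa [vw] using b
    · simpa [vw] using c
  have one : ∀ i j k, Tri i j k → x i < 0 → (0 < x j ∨ |x j| < 1) → (0 < x k ∨ |x k| < 1) → Lit K vs x := by
    intro i j k hT a b c
    have dpos := P.dpos hT
    have ei : vd δ (dp i) i i = -dp i := by simp [vd, hT.i3]
    have ej : vd δ (dp i) i j = 1 := by simp [vd, hT.j3, hT.ij.symm]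
    have ek : vd δ (dp i) i k = 1 := by simp [vd, hT.k3, hT.ik.symm]
    have e3 : vd δ (dp i) i 3 = -δ := by simp [vd]
    refine ⟨_, P.md i hT.i3, Or.inl (lemD0 P.hK P.hK3 hT P.κ0 d0 d1 (P.hdp i j k hT) hx _ ?_ ?_ ?_ ?_ h3 ?_ ?_ ?_)⟩
    · rw [ei, abs_neg, abs_of_pos dpos]
    · rw [ej, abs_one]
    · rw [ek, abs_one]
    · rw [e3, abs_neg, abs_of_pos d0]
    · rw [ei]; exact mul_pos_of_neg_of_neg (by linarith) a
    · rw [ej, one_mul]; exact b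
    · rw [ek, one_mul]; exact c
  have two : ∀ i j k, Tri i j k → 0 < x i → (x j < 0 ∨ |x j| < 1) → (x k < 0 ∨ |x k| < 1) → Lit K vs x := by
    intro i j k hT a b c
    have dpos := P.dpos hT
    have ei : (-vd δ (dp i) i) i = dp i := by simp [vd, hT.i3]
    have ej : (-vd δ (dp i) i) j = -1 := by simp [vd, hT.j3, hT.ij.symm]
    have ek : (-vd δ (dp i) i) k = -1 := by simp [vd, hT.k3, hT.ik.symm]
    have e3 : (-vd δ (dp i) i) 3 = δ := by simp [vd]
    refine ⟨_, P.md i hT.i3, Or.inr ?_⟩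
    rw [← neg_neg (vd δ (dp i) i)]
    refine lemD0 P.hK P.hK3 hT P.κ0 d0 d1 (P.hdp i j k hT) hx _ ?_ ?_ ?_ ?_ h3 ?_ ?_ ?_
    · rw [ei, abs_of_pos dpos]
    · rw [ej, abs_neg, abs_one]
    · rw [ek, abs_neg, abs_one]
    · rw [e3, abs_of_pos d0]
    · rw [ei]; positivity
    · rw [ej]; exact b.imp_left (fun h => by linarith)
    · rw [ek]; exact c.imp_left (fun h => by linarith)
  have twoN : ∀ i j k, Tri i j k → (0 < x i ∨ |x i| < 1) → x j < 0 → x k < 0 →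
      ((x i < 0 ∨ |x i| < 1) → Lit K vs x) → Lit K vs x := by
    intro i j k hT _ b c h
    by_cases hi : x i < 0 ∨ |x i| < 1
    · exact h hi
    · exact two i j k hT (np i hi) (Or.inl b) (Or.inl c)
  have t := tri012
  by_cases a0 : 0 < x 0 ∨ |x 0| < 1 <;> by_cases a1 : 0 < x 1 ∨ |x 1| < 1 <;> by_cases a2 : 0 < x 2 ∨ |x 2| < 1
  · exact allP a0 a1 a2
  · exact one 2 0 1 t.rot.rot (pn 2 a2) a0 a1
  · exact one 1 2 0 t.rot (pn 1 a1) a2 a0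
  · exact twoN 0 1 2 t a0 (pn 1 a1) (pn 2 a2) (fun h => allN h (Or.inl (pn 1 a1)) (Or.inl (pn 2 a2)))
  · exact one 0 1 2 t (pn 0 a0) a1 a2
  · exact twoN 1 2 0 t.rot a1 (pn 2 a2) (pn 0 a0) (fun h => allN (Or.inl (pn 0 a0)) h (Or.inl (pn 2 a2)))
  · exact twoN 2 0 1 t.rot.rot a2 (pn 0 a0) (pn 1 a1) (fun h => allN (Or.inl (pn 0 a0)) (Or.inl (pn 1 a1)) h)
  · exact allN (Or.inl (pn 0 a0)) (Or.inl (pn 1 a1)) (Or.inl (pn 2 a2))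

theorem Par.lit (P : Par K κ δ dp vs) {x : Fin 4 → ℝ} (hx : x ∈ K) : Lit K vs x := by
  rcases lt_trichotomy (x 3) 0 with h | h | h
  · apply lit_neg P.hK
    refine P.pos (down P.hK.conv P.hK.unc hx (fun i => by simp)) ?_
    simpa using h
  · exact P.zero hx h
  · exact P.pos hx h
end

theorem good_k3 {K : Set (Fin 4 → ℝ)} (hK : Nrm K) (h3 : ind [0, 1, 2] ∈ K) (hpar : ¬ IsParallelepiped K) : Good K := by
  classical
  have h4 : ind [0, 1, 2, 3] ∉ K := fun h => hpar (par_full hK h (by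
    intro i
    have : i ∈ [0, 1, 2, 3] := by revert i; decide
    simp [ind, this]))
  have e1 := ev_face1 hK _ h4
  have e2 : ∀ᶠ κ in 𝓝[>] (0:ℝ), ∀ i j k : Fin 4, Tri i j k → (∀ z ∈ K, |z i| + |z 3| ≤ 1) →
      ∀ x ∈ K, ¬ (∀ l ∈ [j, k, 3], 1 - κ < |x l|) := by
    simp only [Filter.eventually_all]
    intro i j k hT hd
    refine ev_face1 hK _ fun h => hpar (par_k3 hK hT.ij hT.ik hT.jk hT.i3 hT.j3 hT.k3 ?_ h hd)
    rw [hT.ind]; exact h3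
  obtain ⟨κ, ⟨f1, f2⟩, κ0, κ1⟩ := ((e1.and e2).and (ev_small 1 one_pos)).exists
  set δ := κ / 2 with hδ
  have δ0 : 0 < δ := by positivity
  let dp : Fin 4 → ℝ := fun i => if ∀ z ∈ K, |z i| + |z 3| ≤ 1 then δ * (1 + κ) else δ
  let vs : List (Fin 4 → ℝ) := [vw δ, vM (3 / κ) 0, vM (3 / κ) 1, vM (3 / κ) 2,
    vd δ (dp 0) 0, vd δ (dp 1) 1, vd δ (dp 2) 2]
  have c3 : ∀ i : Fin 4, i ≠ 3 → i = 0 ∨ i = 1 ∨ i = 2 := by decide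
  have P : Par K κ δ dp vs := by
    refine ⟨hK, h3, κ0, κ1, δ0, by rw [hδ]; linarith, ?_, ?_, ?_, ?_, ?_⟩
    · rintro x hx ⟨a, b, c, d⟩
      exact f1 x hx (by simp [a, b, c, d])
    · intro i j k hT
      by_cases hd : ∀ z ∈ K, |z i| + |z 3| ≤ 1
      · refine Or.inr ⟨if_pos hd, ?_⟩
        rintro x hx ⟨a, b, c⟩
        exact f2 i j k hT hd x hx (by simp [a, b, c])
      · exact Or.inl ⟨if_neg hd, hd⟩
    · simp [vs]
    · intro i hi
      rcases c3 i hi with rfl | rfl | rfl <;> simp [vs]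
    · intro i hi
      rcases c3 i hi with rfl | rfl | rfl <;> simp [vs]
  refine good_of_lit hK vs (by simp [vs]) ?_ (fun x hx => P.lit hx)
  have m3 : (3 / κ) ≠ 0 := by positivity
  have hne : ∀ v : Fin 4 → ℝ, v 3 ≠ 0 → v ≠ 0 := fun v h h0 => h (by rw [h0]; rfl)
  intro v hv
  apply hne
  simp only [vs, List.mem_cons, List.not_mem_nil, or_false] at hv
  rcases hv with rfl | rfl | rfl | rfl | rfl | rfl | rfl
  · simp [vw, δ0.ne']
  · simp [vM, κ0.ne']
  · simp [vM, κ0.ne']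
  · simp [vM, κ0.ne']
  · simp [vd, δ0.ne']
  · simp [vd, δ0.ne']
  · simp [vd, δ0.ne']

end Ill

namespace Ill

/-- adjacency from six booleans -/
def adj4 (a b c d e f : Bool) (i j : Fin 4) : Bool :=
  match i.1, j.1 with
  | 0, 1 => a
  | 1, 0 => a
  | 0, 2 => b
  | 2, 0 => b
  | 0, 3 => c
  | 3, 0 => c
  | 1, 2 => d
  | 2, 1 => d
  | 1, 3 => e
  | 3, 1 => e
  | 2, 3 => f
  | 3, 2 => f
  | _, _ => false

/-- the eleven graphs -/
def canon4 : Fin 11 → List (List (Fin 4)) := ![E4_empty, E4_edgeA, E4_matching, E4_cherry, E4_path, E4_tri, E4_star,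
  E4_c4, E4_paw, E4_diam, E4_full]

/-- permutations as products of transpositions -/
def sw4 (p q r : Fin 4) : Equiv.Perm (Fin 4) := Equiv.swap 0 p * Equiv.swap 1 q * Equiv.swap 2 r

theorem classify4 : ∀ a b c d e f : Bool, ∃ m : Fin 11, ∃ p q r : Fin 4, ∀ i j : Fin 4, i < j →
    (adj4 a b c d e f (sw4 p q r i) (sw4 p q r j) = true ↔ [i, j] ∈ canon4 m) := by
  decide +kernel
end Ill

namespace Ill

theorem perm4_ex : ∀ i j k l : Fin 4, i ≠ j → i ≠ k → i ≠ l → j ≠ k → j ≠ l → k ≠ l →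
    ∃ p q r : Fin 4, sw4 p q r 0 = i ∧ sw4 p q r 1 = j ∧ sw4 p q r 2 = k ∧ sw4 p q r 3 = l := by
  decide +kernel

theorem perm4_ex3 : ∀ i j k : Fin 4, i ≠ j → i ≠ k → j ≠ k →
    ∃ p q r : Fin 4, sw4 p q r 0 = i ∧ sw4 p q r 1 = j ∧ sw4 p q r 2 = k := by
  decide +kernel

theorem fin4_all (i : Fin 4) : i = 0 ∨ i = 1 ∨ i = 2 ∨ i = 3 := by
  revert i; decide

theorem ind_mem_swap {n : ℕ} {K : Set (Fin n → ℝ)} (i j : Fin n) : ind [i, j] ∈ K ↔ ind [j, i] ∈ K := by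
  rw [ind_swap]

theorem empty_aux {K : Set (Fin 4 → ℝ)} (hK : Nrm K) (h3 : NoTriple K)
    (hE : ∀ i j : Fin 4, i ≠ j → ind [i, j] ∉ K) {p q r s : Fin 4}
    (hpq : p ≠ q) (hpr : p ≠ r) (hps : p ≠ s) (hqr : q ≠ r) (hqs : q ≠ s) (hrs : r ≠ s)
    (n1 : Nonbad K p q r) (n2 : Nonbad K r s p) : Good K := by
  obtain ⟨a, b, c, s0, s1, s2, s3⟩ := perm4_ex q s r p hqs hqr hpq.symm hrs.symm hps.symm hpr.symm
  set σ := sw4 a b c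
  apply good_image (permL σ)
  refine g4_empty (nrm_perm hK σ) (noTriple_perm h3 σ) ?_ (nonbad_perm σ ?_) (nonbad_perm σ ?_)
  · rw [prs4_iff]
    simp only [ind_perm, List.map_cons, List.map_nil]
    refine ⟨?_, ?_, ?_, ?_, ?_, ?_⟩ <;>
    · refine iff_of_false (hE _ _ fun h => ?_) (by decide)
      exact absurd (σ.injective h) (by decide)
  · rw [s0, s2, s3]; exact n1
  · rw [s1, s2, s3]; exact n2

theorem good_empty4 {K : Set (Fin 4 → ℝ)} (hK : Nrm K) (h3 : NoTriple K)
    (hE : ∀ i j : Fin 4, i ≠ j → ind [i, j] ∉ K) : Good K := by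
  have key : ∀ u v w t : Fin 4, u ≠ v → u ≠ w → u ≠ t → v ≠ w → v ≠ t → w ≠ t →
      Nonbad K u v w → Nonbad K v u w → Good K := by
    intro u v w t uv uw ut vw vt wt n1 n2
    rcases nonbad_or hK ut vt (hE _ _ uv) (hE _ _ ut) (hE _ _ vt) with h | h
    · exact empty_aux hK h3 hE vw uv.symm vt uw.symm wt ut (nonbad_symm n2) (nonbad_symm h)
    · exact empty_aux hK h3 hE uw uv ut vw.symm wt vt (nonbad_symm n1) (nonbad_symm h)
  have no : ∀ i j k : Fin 4, i ≠ j → i ≠ k → j ≠ k → Nonbad K i j k ∨ Nonbad K j i k :=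
    fun i j k ij ik jk => nonbad_or hK ik jk (hE _ _ ij) (hE _ _ ik) (hE _ _ jk)
  rcases no 0 1 2 (by decide) (by decide) (by decide) with h | h
  · rcases no 1 2 0 (by decide) (by decide) (by decide) with h' | h'
    · exact key 0 1 2 3 (by decide) (by decide) (by decide) (by decide) (by decide) (by decide) h (nonbad_symm h')
    · exact key 0 2 1 3 (by decide) (by decide) (by decide) (by decide) (by decide) (by decide) (nonbad_symm h)
        (nonbad_symm h')
  · rcases no 0 2 1 (by decide) (by decide) (by decide) with h' | h'
    · exact key 0 1 2 3 (by decide) (by decide) (by decide) (by decide) (by decide) (by decide) (nonbad_symm h') h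
    · exact key 1 2 0 3 (by decide) (by decide) (by decide) (by decide) (by decide) (by decide) (nonbad_symm h)
        (nonbad_symm h')

theorem good_edge4 {K : Set (Fin 4 → ℝ)} (hK : Nrm K) (h3 : NoTriple K)
    (hG : ∀ T ∈ prs4, ind T ∈ K ↔ T ∈ E4_edgeA) : Good K := by
  by_cases n0 : Nonbad K 0 2 3
  · exact g4_edgeA hK h3 hG n0
  by_cases n1 : Nonbad K 1 2 3
  · set σ : Equiv.Perm (Fin 4) := Equiv.swap 0 1 with hσ
    have s0 : σ 0 = 1 := by rw [hσ]; decide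
    have s1 : σ 1 = 0 := by rw [hσ]; decide
    have s2 : σ 2 = 2 := by rw [hσ]; decide
    have s3 : σ 3 = 3 := by rw [hσ]; decide
    apply good_image (permL σ)
    refine g4_edgeA (nrm_perm hK σ) (noTriple_perm h3 σ) ?_ (nonbad_perm σ (by rw [s0, s2, s3]; exact n1))
    rw [prs4_iff] at hG ⊢
    simp only [ind_perm, List.map_cons, List.map_nil, s0, s1, s2, s3]
    rw [ind_swap 1 0]
    obtain ⟨a, b, c, d, e, f⟩ := hG
    rw [a, b, c, d, e, f]
    refine ⟨?_, ?_, ?_, ?_, ?_, ?_⟩ <;> decide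
  have h02 : ind [0, 2] ∉ K := fun h => absurd ((hG _ (by decide)).1 h) (by decide)
  have h03 : ind [0, 3] ∉ K := fun h => absurd ((hG _ (by decide)).1 h) (by decide)
  have h12 : ind [1, 2] ∉ K := fun h => absurd ((hG _ (by decide)).1 h) (by decide)
  have h13 : ind [1, 3] ∉ K := fun h => absurd ((hG _ (by decide)).1 h) (by decide)
  have h23 : ind [2, 3] ∉ K := fun h => absurd ((hG _ (by decide)).1 h) (by decide)
  have m0 : Nonbad K 3 0 2 := by
    rcases nonbad_or hK (i := 0) (j := 3) (k := 2) (by decide) (by decide) h03 h02 (by rwa [ind_swap]) with h | h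
    · exact absurd (nonbad_symm h) n0
    · exact h
  have m1 : Nonbad K 2 1 3 := by
    rcases nonbad_or hK (i := 1) (j := 2) (k := 3) (by decide) (by decide) h12 h13 h23 with h | h
    · exact absurd h n1
    · exact h
  exact g4_edgeB hK h3 hG m0 m1

theorem good_cherry4 {K : Set (Fin 4 → ℝ)} (hK : Nrm K) (h3 : NoTriple K)
    (hG : ∀ T ∈ prs4, ind T ∈ K ↔ T ∈ E4_cherry) : Good K := by
  have h02 : ind [0, 2] ∉ K := fun h => absurd ((hG _ (by decide)).1 h) (by decide)
  have h03 : ind [0, 3] ∉ K := fun h => absurd ((hG _ (by decide)).1 h) (by decide)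
  have h23 : ind [2, 3] ∉ K := fun h => absurd ((hG _ (by decide)).1 h) (by decide)
  rcases nonbad_or hK (i := 0) (j := 2) (k := 3) (by decide) (by decide) h02 h03 h23 with h | h
  · exact g4_cherry hK h3 hG h
  · set σ : Equiv.Perm (Fin 4) := Equiv.swap 0 2 with hσ
    have s0 : σ 0 = 2 := by rw [hσ]; decide
    have s1 : σ 1 = 1 := by rw [hσ]; decide
    have s2 : σ 2 = 0 := by rw [hσ]; decide
    have s3 : σ 3 = 3 := by rw [hσ]; decide
    apply good_image (permL σ)
    refine g4_cherry (nrm_perm hK σ) (noTriple_perm h3 σ) ?_ (nonbad_perm σ (by rw [s0, s2, s3]; exact h))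
    rw [prs4_iff] at hG ⊢
    simp only [ind_perm, List.map_cons, List.map_nil, s0, s1, s2, s3]
    rw [ind_swap 2 0, ind_swap 2 1, ind_swap 1 0]
    obtain ⟨a, b, c, d, e, f⟩ := hG
    rw [a, b, c, d, e, f]
    refine ⟨?_, ?_, ?_, ?_, ?_, ?_⟩ <;> decide

theorem good_nt4 {K : Set (Fin 4 → ℝ)} (hK : Nrm K) (h3 : NoTriple K) (hpar : ¬ IsParallelepiped K) : Good K := by
  classical
  obtain ⟨m, p, q, r, hm⟩ := classify4 (decide (ind [0, 1] ∈ K)) (decide (ind [0, 2] ∈ K)) (decide (ind [0, 3] ∈ K))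
    (decide (ind [1, 2] ∈ K)) (decide (ind [1, 3] ∈ K)) (decide (ind [2, 3] ∈ K))
  have hadj : ∀ i j : Fin 4, i ≠ j → (adj4 (decide (ind [0, 1] ∈ K)) (decide (ind [0, 2] ∈ K))
      (decide (ind [0, 3] ∈ K)) (decide (ind [1, 2] ∈ K)) (decide (ind [1, 3] ∈ K)) (decide (ind [2, 3] ∈ K)) i j = true
      ↔ ind [i, j] ∈ K) := by
    intro i j hij
    rcases fin4_all i with rfl | rfl | rfl | rfl <;> rcases fin4_all j with rfl | rfl | rfl | rfl <;>
      first
        | exact absurd rfl hij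
        | exact decide_eq_true_iff
        | exact decide_eq_true_iff.trans (ind_mem_swap _ _)
  set σ := sw4 p q r
  apply good_image (permL σ)
  have hG : ∀ T ∈ prs4, ind T ∈ permL σ '' K ↔ T ∈ canon4 m := by
    have h : ∀ i j : Fin 4, i < j → (ind [i, j] ∈ permL σ '' K ↔ [i, j] ∈ canon4 m) := by
      intro i j hij
      rw [← hm i j hij, hadj _ _ (fun h => hij.ne (σ.injective h)), ind_perm]
      rfl
    rw [prs4_iff]
    exact ⟨h _ _ (by decide), h _ _ (by decide), h _ _ (by decide), h _ _ (by decide), h _ _ (by decide),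
      h _ _ (by decide)⟩
  have hK' := nrm_perm hK σ
  have h3' := noTriple_perm h3 σ
  have hp' : ¬ IsParallelepiped (permL σ '' K) := fun h => hpar (par_image _ h)
  clear hm hadj
  generalize permL σ '' K = K' at *
  match m, hG with
  | 0, hG =>
    refine good_empty4 hK' h3' ?_
    rw [prs4_iff] at hG
    obtain ⟨a, b, c, d, e, f⟩ := hG
    intro i j hij
    rcases fin4_all i with rfl | rfl | rfl | rfl <;> rcases fin4_all j with rfl | rfl | rfl | rfl <;>
      first
        | exact absurd rfl hij
        | (first
            | rw [a]
            | rw [b]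
            | rw [c]
            | rw [d]
            | rw [e]
            | rw [f]
            | rw [ind_swap, a]
            | rw [ind_swap, b]
            | rw [ind_swap, c]
            | rw [ind_swap, d]
            | rw [ind_swap, e]
            | rw [ind_swap, f]) <;> decide
  | 1, hG => exact good_edge4 hK' h3' hG
  | 2, hG => exact g4_matching hK' h3' hG
  | 3, hG => exact good_cherry4 hK' h3' hG
  | 4, hG => exact g4_path hK' h3' hG
  | 5, hG => exact g4_tri hK' h3' hG
  | 6, hG => exact g4_star hK' h3' hG
  | 7, hG => exact g4_c4 hK' h3' hG hp'
  | 8, hG => exact g4_paw hK' h3' hG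
  | 9, hG => exact g4_diam hK' h3' hG
  | 10, hG => exact g4_full hK' h3' hG

theorem good4 {K : Set (Fin 4 → ℝ)} (hK : Nrm K) (hpar : ¬ IsParallelepiped K) : Good K := by
  by_cases h3 : NoTriple K
  · exact good_nt4 hK h3 hpar
  unfold NoTriple at h3
  push Not at h3
  obtain ⟨i, j, k, ij, ik, jk, h⟩ := h3
  obtain ⟨p, q, r, s0, s1, s2⟩ := perm4_ex3 i j k ij ik jk
  apply good_image (permL (sw4 p q r))
  refine good_k3 (nrm_perm hK _) ?_ (fun h => hpar (par_image _ h))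
  rw [ind_perm]
  simp only [List.map_cons, List.map_nil, s0, s1, s2]
  exact h

/-- adjacency from three booleans -/
def adj3 (a b c : Bool) (i j : Fin 3) : Bool :=
  match i.1, j.1 with
  | 0, 1 => a
  | 1, 0 => a
  | 0, 2 => b
  | 2, 0 => b
  | 1, 2 => c
  | 2, 1 => c
  | _, _ => false

/-- the four graphs -/
def canon3 : Fin 4 → List (List (Fin 3)) := ![E3_empty, E3_edge, E3_path, E3_tri]

/-- permutations as products of transpositions -/
def sw3 (p q : Fin 3) : Equiv.Perm (Fin 3) := Equiv.swap 0 p * Equiv.swap 1 q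

theorem classify3 : ∀ a b c : Bool, ∃ m : Fin 4, ∃ p q : Fin 3, ∀ i j : Fin 3, i < j →
    (adj3 a b c (sw3 p q i) (sw3 p q j) = true ↔ [i, j] ∈ canon3 m) := by
  decide +kernel

theorem fin3_cases (i : Fin 3) : i = 0 ∨ i = 1 ∨ i = 2 := by
  revert i; decide

theorem prs3_of {K : Set (Fin 3 → ℝ)} {E : List (List (Fin 3))} (a : ind [0, 1] ∈ K ↔ [0, 1] ∈ E)
    (b : ind [0, 2] ∈ K ↔ [0, 2] ∈ E) (c : ind [1, 2] ∈ K ↔ [1, 2] ∈ E) : ∀ T ∈ prs3, ind T ∈ K ↔ T ∈ E := by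
  intro T hT
  simp only [List.mem_cons, List.not_mem_nil, or_false] at hT
  rcases hT with rfl | rfl | rfl
  · exact a
  · exact b
  · exact c

theorem full3 {K : Set (Fin 3 → ℝ)} (hK : Nrm K) (hpar : ¬ IsParallelepiped K) : ind [0, 1, 2] ∉ K := by
  intro h
  refine hpar (par_full hK h ?_)
  intro i
  have : i ∈ [0, 1, 2] := by revert i; decide
  simp [ind, this]

theorem good_empty3 {K : Set (Fin 3 → ℝ)} (hK : Nrm K) (hpar : ¬ IsParallelepiped K)
    (hG : ∀ T ∈ prs3, ind T ∈ K ↔ T ∈ E3_empty) : Good K := by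
  have h01 : ind [0, 1] ∉ K := fun h => absurd ((hG _ (by decide)).1 h) (by decide)
  have h02 : ind [0, 2] ∉ K := fun h => absurd ((hG _ (by decide)).1 h) (by decide)
  have h12 : ind [1, 2] ∉ K := fun h => absurd ((hG _ (by decide)).1 h) (by decide)
  rcases nonbad_or hK (i := 2) (j := 1) (k := 0) (by decide) (by decide) (by rwa [ind_swap]) (by rwa [ind_swap])
    (by rwa [ind_swap]) with h | h
  · exact g3_empty hK (full3 hK hpar) hG (nonbad_symm h)
  · set σ : Equiv.Perm (Fin 3) := Equiv.swap 1 2 with hσ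
    have s0 : σ 0 = 0 := by rw [hσ]; decide
    have s1 : σ 1 = 2 := by rw [hσ]; decide
    have s2 : σ 2 = 1 := by rw [hσ]; decide
    apply good_image (permL σ)
    refine g3_empty (nrm_perm hK σ) (full3 (nrm_perm hK σ) fun h => hpar (par_image _ h)) ?_
      (nonbad_perm σ (by rw [s0, s1, s2]; exact nonbad_symm h))
    refine prs3_of (iff_of_false ?_ (by decide)) (iff_of_false ?_ (by decide)) (iff_of_false ?_ (by decide)) <;>
      simp only [ind_perm, List.map_cons, List.map_nil, s0, s1, s2]
    · exact h02
    · exact h01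
    · rwa [ind_swap]

theorem good3 {K : Set (Fin 3 → ℝ)} (hK : Nrm K) (hpar : ¬ IsParallelepiped K) : Good K := by
  classical
  obtain ⟨m, p, q, hm⟩ := classify3 (decide (ind [0, 1] ∈ K)) (decide (ind [0, 2] ∈ K)) (decide (ind [1, 2] ∈ K))
  have hadj : ∀ i j : Fin 3, i ≠ j → (adj3 (decide (ind [0, 1] ∈ K)) (decide (ind [0, 2] ∈ K))
      (decide (ind [1, 2] ∈ K)) i j = true ↔ ind [i, j] ∈ K) := by
    intro i j hij
    rcases fin3_cases i with rfl | rfl | rfl <;> rcases fin3_cases j with rfl | rfl | rfl <;>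
      first
        | exact absurd rfl hij
        | exact decide_eq_true_iff
        | exact decide_eq_true_iff.trans (ind_mem_swap _ _)
  set σ := sw3 p q
  apply good_image (permL σ)
  have hG : ∀ T ∈ prs3, ind T ∈ permL σ '' K ↔ T ∈ canon3 m := by
    have h : ∀ i j : Fin 3, i < j → (ind [i, j] ∈ permL σ '' K ↔ [i, j] ∈ canon3 m) := by
      intro i j hij
      rw [← hm i j hij, hadj _ _ (fun h => hij.ne (σ.injective h)), ind_perm]
      rfl
    exact prs3_of (h _ _ (by decide)) (h _ _ (by decide)) (h _ _ (by decide))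
  have hK' := nrm_perm hK σ
  have hp' : ¬ IsParallelepiped (permL σ '' K) := fun h => hpar (par_image _ h)
  clear hm hadj
  generalize permL σ '' K = K' at *
  have h3' := full3 hK' hp'
  match m, hG with
  | 0, hG => exact good_empty3 hK' hp' hG
  | 1, hG => exact g3_edge hK' h3' hG
  | 2, hG => exact g3_path hK' h3' hG hp'
  | 3, hG => exact g3_tri hK' h3' hG

theorem good_all (n : ℕ) (hn : n = 3 ∨ n = 4) (K : Set (Fin n → ℝ))
    (hbody : IsConvexBody K) (huncond : Unconditional K)
    (hpar : ¬ IsParallelepiped K) : Good K := by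
  obtain ⟨L, hL⟩ := normalize hbody huncond
  apply good_image L
  have hp : ¬ IsParallelepiped (L '' K) := fun h => hpar (par_image L h)
  rcases hn with rfl | rfl
  · exact good3 hL hp
  · exact good4 hL hp

end Ill

/-- For `n ∈ {3,4}`, every 1-unconditional convex body in `ℝ^n`
that is not a parallelepiped has illumination number at most `2^n - 2`, witnessed
by a symmetric set of nonzero directions of cardinality at most `2^n - 2`. -/
theorem stmt0 (n : ℕ) (hn : n = 3 ∨ n = 4) (K : Set (Fin n → ℝ))
    (hbody : IsConvexBody K) (huncond : Unconditional K)
    (hpar : ¬ IsParallelepiped K) :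
    illumNumber K ≤ 2 ^ n - 2 ∧
      ∃ D : Finset (Fin n → ℝ), (∀ d ∈ D, d ≠ 0) ∧ (∀ d ∈ D, -d ∈ D) ∧
        D.card ≤ 2 ^ n - 2 ∧ IlluminatesSet K ↑D := by
  obtain ⟨D, h1, h2, h3, h4⟩ := Ill.good_all n hn K hbody huncond hpar
  have h5 : illumNumber K ≤ D.card := by
    unfold illumNumber
    apply Nat.sInf_le
    exact ⟨D, rfl, h1, h4⟩
  exact ⟨h5.trans h3, D, h1, h2, h3, h4⟩
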